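/- arXiv:2104.00101 — 2 statements merged into one kernel-verified Lean document; each statement's English description precedes it below -/
import Mathlib

section
/- Let α₁, …, α_r be continuously differentiable extended class 𝒦 functions, q : [t₀, ∞) → ℝ continuous with q(t) ≥ 0 for all t, and p the associated cascade vector field as in the context. Then the nonnegative orthant ℝ^r_+ is globally attractive for ψ̇ = p(t, ψ): every solution ψ : [t₀, ∞) → ℝ^r satisfies dist(ψ(t), ℝ^r_+) → 0 as t → ∞, where dist denotes the Euclidean distance from a point to the set ℝ^r_+ = {v ∈ ℝ^r : v_i ≥ 0 for all i}. -/
/-- If the derivative is at least `δ > 0` whenever `u ≤ c`, then eventually `c ≤ u`. -/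
theorem eventually_ge_of_deriv (u u' : ℝ → ℝ) (T c δ : ℝ) (hδ : 0 < δ)
    (hu : ∀ t, T ≤ t → HasDerivAt u (u' t) t)
    (h : ∀ t, T ≤ t → u t ≤ c → δ ≤ u' t) :
    ∀ᶠ t in Filter.atTop, c ≤ u t := by
  have hex : ∃ s, T ≤ s ∧ c ≤ u s := by
    by_contra hno
    push Not at hno
    have key : ∀ b, ∀ x ∈ Set.Icc T b, -u x ≤ -u T - (δ / 2) * (x - T) := by
      intro b
      refine image_le_of_deriv_right_lt_deriv_boundary (f := fun x => -u x)
        (f' := fun x => -u' x) (B := fun x => -u T - (δ / 2) * (x - T))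
        (B' := fun _ => -(δ / 2)) ?_ ?_ ?_ ?_ ?_
      · intro x hx
        exact (hu x hx.1).neg.continuousAt.continuousWithinAt
      · intro x hx
        exact (hu x hx.1).neg.hasDerivWithinAt
      · simp
      · intro x
        have := (((hasDerivAt_id x).sub_const T).const_mul (δ / 2)).const_sub (-u T)
        simpa using this
      · intro x hx _
        have := h x hx.1 (hno x hx.1).le
        linarith
    have hT := hno T le_rfl
    have hx0 : 0 ≤ 2 * (c - u T) / δ := by
      apply div_nonneg <;> linarith
    have h1 := key (T + 2 * (c - u T) / δ) (T + 2 * (c - u T) / δ) ⟨by linarith, le_rfl⟩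
    have h2 := hno (T + 2 * (c - u T) / δ) (by linarith)
    have h3 : (δ / 2) * (T + 2 * (c - u T) / δ - T) = c - u T := by
      field_simp
      ring
    linarith
  obtain ⟨s, hs, hcs⟩ := hex
  filter_upwards [Filter.eventually_ge_atTop s] with t ht
  have key : ∀ x ∈ Set.Icc s t, -u x ≤ -c := by
    refine image_le_of_deriv_right_lt_deriv_boundary (f := fun x => -u x)
      (f' := fun x => -u' x) (B := fun _ => -c) (B' := fun _ => 0) ?_ ?_ ?_ ?_ ?_
    · intro x hx
      exact (hu x (hs.trans hx.1)).neg.continuousAt.continuousWithinAt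
    · intro x hx
      exact (hu x (hs.trans hx.1)).neg.hasDerivWithinAt
    · simpa using hcs
    · intro x
      exact hasDerivAt_const x _
    · intro x hx he
      have := h x (hs.trans hx.1) (by simp at he; linarith)
      linarith
  have := key t ⟨ht, le_rfl⟩
  linarith


/-- the nonnegative orthant is globally attractive for the
cascade system `ψ̇ = p(t, ψ)` with nonnegative forcing `q`:
`dist(ψ(t), ℝ^r₊) → 0` as `t → ∞`. -/
theorem cascade_orthant_attractive {r : ℕ} (hr : 1 ≤ r) (t₀ : ℝ)
    (α : ℕ → ℝ → ℝ)
    (hα : ∀ k, 1 ≤ k → k ≤ r →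
      ContDiff ℝ 1 (α k) ∧ StrictMono (α k) ∧ α k 0 = 0)
    (q : ℝ → ℝ) (hq_cont : ContinuousOn q (Set.Ici t₀))
    (hq_nonneg : ∀ t ∈ Set.Ici t₀, 0 ≤ q t)
    (P : ℝ → EuclideanSpace ℝ (Fin r) → EuclideanSpace ℝ (Fin r))
    (hP : ∀ t, ∀ v : EuclideanSpace ℝ (Fin r), ∀ i : Fin r, P t v i =
      -α (i.val + 1) (v i) + (if hi : i.val + 1 < r then v ⟨i.val + 1, hi⟩ else q t))
    (ψ : ℝ → EuclideanSpace ℝ (Fin r))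
    (hψ : ∀ t ∈ Set.Ici t₀, HasDerivAt ψ (P t (ψ t)) t) :
    Filter.Tendsto
      (fun t => Metric.infDist (ψ t) {v : EuclideanSpace ℝ (Fin r) | ∀ i, 0 ≤ v i})
      Filter.atTop (nhds 0) := by
  have hcomp : ∀ i : Fin r, ∀ t, t₀ ≤ t → HasDerivAt (fun s => ψ s i) (P t (ψ t) i) t := by
    intro i t ht
    exact ((EuclideanSpace.proj (𝕜 := ℝ) i).hasFDerivAt.comp_hasDerivAt t (hψ t ht))
  have step : ∀ i : Fin r, (∀ δ > 0, ∀ᶠ t in Filter.atTop,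
      -δ ≤ (if hi : i.val + 1 < r then ψ t ⟨i.val + 1, hi⟩ else q t)) →
      ∀ ε > 0, ∀ᶠ t in Filter.atTop, -ε ≤ ψ t i := by
    intro i hi ε hε
    obtain ⟨-, hm, h0⟩ := hα (i.val + 1) (by omega) (by omega)
    have hneg : α (i.val + 1) (-ε) < 0 := by
      rw [← h0]
      exact hm (by linarith)
    obtain ⟨T, hT⟩ := Filter.eventually_atTop.1 (hi (-α (i.val + 1) (-ε) / 2) (by linarith))
    refine eventually_ge_of_deriv (fun s => ψ s i) (fun t => P t (ψ t) i) (max T t₀) (-ε)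
      (-α (i.val + 1) (-ε) / 2) (by linarith)
      (fun t ht => hcomp i t (le_trans (le_max_right _ _) ht)) ?_
    intro t ht hle
    have h1 := hT t (le_trans (le_max_left _ _) ht)
    have h2 := hm.monotone hle
    simp only [hP]
    linarith
  have all : ∀ n : ℕ, ∀ i : Fin r, i.val + 1 + n = r →
      ∀ ε > 0, ∀ᶠ t in Filter.atTop, -ε ≤ ψ t i := by
    intro n
    induction n with
    | zero =>
      intro i hi
      apply step i
      intro δ hδ
      filter_upwards [Filter.eventually_ge_atTop t₀] with t ht
      rw [dif_neg (by omega)]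
      have := hq_nonneg t ht
      linarith
    | succ n ih =>
      intro i hi
      apply step i
      intro δ hδ
      have hlt : i.val + 1 < r := by omega
      filter_upwards [ih ⟨i.val + 1, hlt⟩ (by simp only; omega) δ hδ] with t ht
      rw [dif_pos hlt]
      exact ht
  have coord : ∀ i : Fin r, Filter.Tendsto (fun t => dist (ψ t i) (max (ψ t i) 0))
      Filter.atTop (nhds 0) := by
    intro i
    rw [Metric.tendsto_nhds]
    intro ε hε
    filter_upwards [all (r - (i.val + 1)) i (by omega) (ε / 2) (by linarith)] with t ht
    rw [Real.dist_0_eq_abs, abs_of_nonneg dist_nonneg, Real.dist_eq]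
    rcases le_total (ψ t i) 0 with h | h
    · rw [max_eq_right h, sub_zero, abs_of_nonpos h]
      linarith
    · rw [max_eq_left h, sub_self, abs_zero]
      exact hε
  have hlim : Filter.Tendsto (fun t => dist (ψ t)
      (WithLp.toLp 2 (fun i => max (ψ t i) 0) : EuclideanSpace ℝ (Fin r)))
      Filter.atTop (nhds 0) := by
    simp only [EuclideanSpace.dist_eq]
    have h1 := (tendsto_finsetSum Finset.univ (fun i _ => (coord i).pow 2)).sqrt
    simpa using h1
  refine squeeze_zero (fun t => Metric.infDist_nonneg) (fun t => ?_) hlim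
  apply Metric.infDist_le_dist_of_mem
  intro i
  exact le_max_right _ _
end

section
/- Assume the setting of the context: b has least relative degree r in the open set D ⊇ C_b, ξ > 0, E := {x ∈ D : L_g L_f^{r-1} b(x) = 0} ⊆ C_{b,ξ}, h(x) = χ(b(x)/ξ), and ψ₀, …, ψ_{r-1} are defined from h and the α's, with α_r another continuously differentiable extended class 𝒦 function. Suppose the nominal controller u_nom : D → ℝ^m is bounded and locally Lipschitz on D, and that the maps x ↦ L_g ψ_{r-1}(x) and x ↦ L_f ψ_{r-1}(x) are locally Lipschitz on D. Define u : D → ℝ^m by u(x) = u_nom(x) + μ(x) L_g ψ_{r-1}(x)ᵀ, where μ(x) = 0 if L_g ψ_{r-1}(x) u_nom(x) + α_r(ψ_{r-1}(x)) + L_f ψ_{r-1}(x) ≥ 0, and μ(x) = −(L_g ψ_{r-1}(x) u_nom(x) + α_r(ψ_{r-1}(x)) + L_f ψ_{r-1}(x)) / ‖L_g ψ_{r-1}(x)‖² otherwise. Then u is well-defined and locally Lipschitz continuous on D. -/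
/-- Lie derivative of a scalar function `φ` along a vector field `f`. -/
noncomputable def LieD {n : ℕ}
    (f : EuclideanSpace ℝ (Fin n) → EuclideanSpace ℝ (Fin n))
    (φ : EuclideanSpace ℝ (Fin n) → ℝ) : EuclideanSpace ℝ (Fin n) → ℝ :=
  fun x => fderiv ℝ φ x (f x)

section Helpers
open Set Filter Topology


/-- Taylor flatness of the cutoff at `1`. -/
lemma chi_flat {r : ℕ} {χ : ℝ → ℝ} (hχ : ContDiff ℝ r χ)
    (h1 : ∀ τ : ℝ, 1 ≤ τ → χ τ = 1) :
    (fun x => χ x - 1) =o[𝓝 1] fun x => (x - 1) ^ r := by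
  have key := taylor_isLittleO_univ (x₀ := 1) hχ
  have hz : ∀ k, 1 ≤ k → k ≤ r → iteratedDeriv k χ 1 = 0 := by
    intro k hk hkr
    have hc : Continuous (iteratedDeriv k χ) := hχ.continuous_iteratedDeriv k (by exact_mod_cast hkr)
    have hev : ∀ x ∈ Ioi (1:ℝ), iteratedDeriv k χ x = 0 := by
      intro x hx
      have : χ =ᶠ[𝓝 x] fun _ => (1:ℝ) := by
        filter_upwards [Ioi_mem_nhds hx] with y hy using h1 y (le_of_lt hy)
      rw [this.iteratedDeriv_eq k, iteratedDeriv_const]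
      simp; omega
    have hcl : IsClosed {x | iteratedDeriv k χ x = 0} := isClosed_eq hc continuous_const
    have : closure (Ioi (1:ℝ)) ⊆ {x | iteratedDeriv k χ x = 0} := hcl.closure_subset_iff.2 hev
    rw [closure_Ioi] at this
    exact this self_mem_Ici
  have : ∀ x, taylorWithinEval χ r univ 1 x = 1 := by
    intro x
    rw [taylor_within_apply, Finset.sum_eq_single 0]
    · simp [h1]
    · intro k hk hk0
      rw [iteratedDerivWithin_univ, hz k (by omega) (by simpa [Nat.lt_succ_iff] using hk)]
      simp
    · simp
  simpa [this] using key

lemma fence_lemma {e e' : ℝ → ℝ} {s l E v : ℝ} (hl : 0 < l) (hE : 0 < E)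
    (hv : 8 * v ≤ E * l)
    (hd : ∀ t ∈ Icc s (s + l), HasDerivAt e (e' t) t)
    (hb : ∀ t ∈ Icc s (s + l), e t ≤ v → E / 2 ≤ e' t) :
    (∀ t ∈ Icc (s + 3 * l / 4) (s + l), v ≤ e t) ∨ (∀ t ∈ Icc s (s + l / 4), e t ≤ -v) := by
  by_cases h : ∀ t ∈ Icc (s + 3 * l / 4) (s + l), v ≤ e t
  · exact Or.inl h
  right
  push Not at h
  obtain ⟨t1, ht1, hlt⟩ := h
  have hcross : ∀ t ∈ Icc s t1, e t < v := by
    intro t ht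
    by_contra hc
    push Not at hc
    have := image_le_of_deriv_right_lt_deriv_boundary (f := fun x => - e x) (f' := fun x => - e' x)
      (a := t) (b := t1) (B := fun _ => -v) (B' := fun _ => 0)
      (fun x hx => ((hd x ⟨by linarith [ht.1, hx.1], by linarith [ht1.2, hx.2]⟩).continuousAt.continuousWithinAt).neg)
      (fun x hx => ((hd x ⟨by linarith [ht.1, hx.1], by linarith [ht1.2, hx.2]⟩).neg).hasDerivWithinAt)
      (by simpa using hc) (fun x => hasDerivAt_const x _)
      (by
        intro x hx hxe
        have := hb x ⟨by linarith [ht.1, hx.1], by linarith [ht1.2, hx.2]⟩ (by linarith)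
        linarith) (x := t1) ⟨ht.2, le_rfl⟩
    linarith
  intro t ht
  have htt : t ≤ t1 := by linarith [ht.2, ht1.1]
  have hfin := image_le_of_deriv_right_le_deriv_boundary (f := fun x => E / 2 * (x - t)) (f' := fun _ => E / 2)
      (a := t) (b := t1) (B := fun x => e x - e t) (B' := fun x => e' x)
      (by fun_prop) (fun x hx => by
        simpa using (((hasDerivAt_id x).sub_const t).const_mul (E/2)).hasDerivWithinAt)
      (by simp)
      (fun x hx => ((hd x ⟨by linarith [ht.1, hx.1], by linarith [ht1.2, hx.2]⟩).continuousAt.continuousWithinAt).sub_const _)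
      (fun x hx => ((hd x ⟨by linarith [ht.1, hx.1], by linarith [ht1.2, hx.2]⟩).sub_const _).hasDerivWithinAt)
      (by
        intro x hx
        exact hb x ⟨by linarith [ht.1, hx.1], by linarith [ht1.2, hx.2]⟩
          (hcross x ⟨by linarith [ht.1, hx.1], by linarith [hx.2]⟩).le) (x := t1) ⟨htt, le_rfl⟩
  have : l / 2 ≤ t1 - t := by linarith [ht.2, ht1.1]
  nlinarith

/-- `e` is bounded away from zero, with constant sign, on a subinterval. -/
def BigOn (e : ℝ → ℝ) (T K lam : ℝ) (m : ℕ) : Prop :=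
  ∃ s, 0 ≤ s ∧ s + lam * T ≤ T ∧ ((∀ t ∈ Icc s (s + lam * T), K * T ^ m ≤ e t) ∨
    (∀ t ∈ Icc s (s + lam * T), e t ≤ -(K * T ^ m)))

lemma bigOn_step {φ : ℝ → ℝ} (M : ℝ) (hM : 1 ≤ M) (hφ0 : ∀ e, 0 ≤ e → e ≤ 1 → φ e ≤ M * e)
    (hφ0' : ∀ e, e ≤ 0 → -1 ≤ e → M * e ≤ φ e) (hn : ∀ e, e ≤ 0 → φ e ≤ 0)
    (hp : ∀ e, 0 ≤ e → 0 ≤ φ e) (K lam : ℝ) (hK : 0 < K) (hlam : 0 < lam) (hlam1 : lam ≤ 1) (m : ℕ) :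
    ∃ K' > 0, ∀ T, 0 < T → T ≤ 1 → ∀ e e1 : ℝ → ℝ,
      (∀ t ∈ Icc 0 T, HasDerivAt e (e1 t - φ (e t)) t) → BigOn e1 T K lam m →
      BigOn e T K' (lam / 4) (m + 1) := by
  set K0 := min K 1 with hK0
  have hK0p : 0 < K0 := lt_min hK one_pos
  refine ⟨K0 * lam / (8 * M), by positivity, ?_⟩
  intro T hT hT1 e e1 hd ⟨s, hs0, hsT, hs⟩
  have hTm : 0 < T ^ m := by positivity
  have hTm1 : T ^ m ≤ 1 := pow_le_one₀ hT.le hT1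
  set E := K0 * T ^ m with hE
  have hEp : 0 < E := by positivity
  have hE1 : E ≤ 1 := by
    have : K0 ≤ 1 := min_le_right _ _
    nlinarith
  have hEK : E ≤ K * T ^ m := mul_le_mul_of_nonneg_right (min_le_left _ _) hTm.le
  set l := lam * T with hl
  have hlp : 0 < l := by positivity
  have hl1 : l ≤ 1 := by nlinarith
  have hveq : K0 * lam / (8 * M) * T ^ (m + 1) = E * l / (8 * M) := by
    rw [hE, hl]; field_simp; ring
  set v := E * l / (8 * M) with hv
  have hvp : 0 < v := by positivity
  have hvM : M * v = E * l / 8 := by rw [hv]; field_simp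
  have hElE : E * l ≤ E := by nlinarith
  have h8 : 8 * v ≤ E * l := by nlinarith
  have hv1 : v ≤ 1 := by nlinarith
  have hMv : M * v ≤ E / 2 := by nlinarith
  have hd' : ∀ t ∈ Icc s (s + l), HasDerivAt e (e1 t - φ (e t)) t := fun t ht =>
    hd t ⟨by linarith [ht.1], by linarith [ht.2]⟩
  have hl4 : lam / 4 * T = l / 4 := by rw [hl]; ring
  unfold BigOn
  rw [hveq, hl4]
  rcases hs with hs | hs
  · rcases fence_lemma (v := v) hlp hEp h8 hd' (by
      intro t ht hle
      have h1 := hs t ht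
      rcases le_total (e t) 0 with h0 | h0
      · have := hn _ h0; linarith
      · have := hφ0 _ h0 (hle.trans hv1)
        have : M * e t ≤ M * v := by gcongr
        linarith) with h | h
    · refine ⟨s + 3 * l / 4, by linarith, by linarith, Or.inl ?_⟩
      intro t ht; exact h t ⟨ht.1, by linarith [ht.2]⟩
    · exact ⟨s, hs0, by linarith, Or.inr h⟩
  · rcases fence_lemma (e := fun t => - e t) (e' := fun t => -(e1 t - φ (e t))) (v := v) hlp hEp h8
      (fun t ht => (hd' t ht).neg) (by
      intro t ht hle
      have h1 := hs t ht
      rcases le_total 0 (e t) with h0 | h0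
      · have := hp _ h0; linarith
      · have := hφ0' _ h0 (by linarith)
        have : M * (- e t) ≤ M * v := by gcongr
        linarith) with h | h
    · refine ⟨s + 3 * l / 4, by linarith, by linarith, Or.inr ?_⟩
      intro t ht
      have := h t ⟨ht.1, by linarith [ht.2]⟩
      linarith
    · refine ⟨s, hs0, by linarith, Or.inl ?_⟩
      intro t ht
      have := h t ht
      linarith

lemma bigOn_step_alpha {α : ℝ → ℝ} (hα : ContDiff ℝ 1 α) (hmono : StrictMono α) (c : ℝ)
    (K lam : ℝ) (hK : 0 < K) (hlam : 0 < lam) (hlam1 : lam ≤ 1) (m : ℕ) :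
    ∃ K' > 0, ∀ T, 0 < T → T ≤ 1 → ∀ e e1 : ℝ → ℝ,
      (∀ t ∈ Icc 0 T, HasDerivAt e (e1 t - (α (c + e t) - α c)) t) → BigOn e1 T K lam m →
      BigOn e T K' (lam / 4) (m + 1) := by
  obtain ⟨C, hC⟩ := (isCompact_Icc (a := c - 1) (b := c + 1)).exists_bound_of_continuousOn
    (hα.continuous_deriv le_rfl).continuousOn
  set M := max C 1 with hM
  have hlip : ∀ x ∈ Icc (c-1) (c+1), ∀ y ∈ Icc (c-1) (c+1), ‖α y - α x‖ ≤ M * ‖y - x‖ := by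
    intro x hx y hy
    exact (convex_Icc (c-1) (c+1)).norm_image_sub_le_of_norm_deriv_le
      (fun z _ => (hα.differentiable (by simp)) z)
      (fun z hz => (hC z hz).trans (le_max_left _ _)) hx hy
  refine bigOn_step (φ := fun e => α (c + e) - α c) M (le_max_right _ _) ?_ ?_ ?_ ?_ K lam hK hlam hlam1 m
  · intro e h0 h1
    have := hlip c ⟨by linarith, by linarith⟩ (c + e) ⟨by linarith, by linarith⟩
    rw [Real.norm_eq_abs, Real.norm_eq_abs, add_sub_cancel_left, abs_of_nonneg h0] at this
    exact (le_abs_self _).trans this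
  · intro e h0 h1
    have := hlip c ⟨by linarith, by linarith⟩ (c + e) ⟨by linarith, by linarith⟩
    rw [Real.norm_eq_abs, Real.norm_eq_abs, add_sub_cancel_left, abs_of_nonpos h0] at this
    have := neg_abs_le (α (c + e) - α c)
    linarith
  · intro e h0
    simpa using hmono.monotone (show c + e ≤ c by linarith)
  · intro e h0
    simpa using hmono.monotone (show c ≤ c + e by linarith)

/-- Local trajectories staying in a prescribed ball. -/
lemma local_traj {E : Type*} [NormedAddCommGroup E] [NormedSpace ℝ E] [CompleteSpace E]
    {f : E → E} {x0 : E} (hf : ContDiffAt ℝ 1 f x0) {ρ : ℝ} (hρ : 0 < ρ) :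
    ∃ δ > 0, ∃ ρ' > 0, ∀ x ∈ Metric.ball x0 ρ', ∃ γ : ℝ → E, γ 0 = x ∧
      ∀ t ∈ Icc 0 δ, HasDerivAt γ (f (γ t)) t ∧ γ t ∈ Metric.ball x0 ρ := by
  obtain ⟨ε, hε, a, r, _, _, hr, hpl⟩ := IsPicardLindelof.of_contDiffAt_one hf
  obtain ⟨β, hβ, hcont⟩ := (hpl 0).exists_forall_mem_closedBall_eq_hasDerivWithinAt_continuousOn
  have hn : Metric.closedBall x0 (r:ℝ) ×ˢ Icc (0 - ε) (0 + ε) ∈ 𝓝 (x0, (0:ℝ)) :=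
    prod_mem_nhds (Metric.closedBall_mem_nhds _ (by exact_mod_cast hr))
      (Icc_mem_nhds (by linarith) (by linarith))
  have hca : ContinuousAt β (x0, (0:ℝ)) := hcont.continuousAt hn
  have h0 : β (x0, 0) = x0 := (hβ x0 (Metric.mem_closedBall_self r.2)).1
  have hev : ∀ᶠ p in 𝓝 (x0, (0:ℝ)), β p ∈ Metric.ball x0 ρ :=
    hca.eventually_mem (by rw [h0]; exact Metric.ball_mem_nhds _ hρ)
  rw [nhds_prod_eq] at hev
  obtain ⟨pa, hpa, pb, hpb, hab⟩ := eventually_prod_iff.1 hev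
  obtain ⟨ρ1, hρ1, hb1⟩ := Metric.eventually_nhds_iff.1 hpa
  obtain ⟨δ1, hδ1, hb2⟩ := Metric.eventually_nhds_iff.1 hpb
  refine ⟨min (δ1 / 2) (ε / 2), by positivity, min ρ1 r, lt_min hρ1 (by exact_mod_cast hr), ?_⟩
  intro x hx
  have hx1 : dist x x0 < ρ1 := lt_of_lt_of_le (Metric.mem_ball.1 hx) (min_le_left _ _)
  have hx2 : x ∈ Metric.closedBall x0 (r:ℝ) :=
    Metric.mem_closedBall.2 (lt_of_lt_of_le (Metric.mem_ball.1 hx) (min_le_right _ _)).le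
  refine ⟨fun t => β (x, t), (hβ x hx2).1, ?_⟩
  intro t ht
  have ht1 : t ≤ δ1 / 2 := ht.2.trans (min_le_left _ _)
  have ht2 : t ≤ ε / 2 := ht.2.trans (min_le_right _ _)
  have ht0 := ht.1
  refine ⟨((hβ x hx2).2 t ⟨by linarith, by linarith⟩).hasDerivAt
    (Icc_mem_nhds (by linarith) (by linarith)), ?_⟩
  refine hab (hb1 hx1) (hb2 ?_)
  rw [Real.dist_eq, sub_zero, abs_of_nonneg ht0]; linarith


/-- Local section of a submersion. -/
lemma local_section {E V : Type*} [NormedAddCommGroup E] [NormedSpace ℝ E]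
    [NormedAddCommGroup V] [NormedSpace ℝ V] [CompleteSpace V] [FiniteDimensional ℝ V]
    {Y : E → V} {Y' : E →L[ℝ] V} {x : E} (hY : HasStrictFDerivAt Y Y' x)
    (hs : Function.Surjective Y') :
    ∃ (σ : V → E) (σ' : V →L[ℝ] E), σ (Y x) = x ∧ HasStrictFDerivAt σ σ' (Y x) ∧
      ∀ᶠ y in 𝓝 (Y x), Y (σ y) = y := by
  obtain ⟨R, hR⟩ := (Y' : E →ₗ[ℝ] V).exists_rightInverse_of_surjective (LinearMap.range_eq_top.2 hs)
  set Rc : V →L[ℝ] E := LinearMap.toContinuousLinearMap R with hRc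
  have hcomp : Y'.comp Rc = ContinuousLinearMap.id ℝ V := by
    ext v
    exact congrArg (fun l : V →ₗ[ℝ] V => l v) hR
  have hinner : HasStrictFDerivAt (fun v : V => x + Rc v) Rc 0 :=
    (Rc.hasStrictFDerivAt).const_add x
  have hx : x + Rc 0 = x := by simp
  have hG : HasStrictFDerivAt (fun v : V => Y (x + Rc v))
      ((ContinuousLinearEquiv.refl ℝ V : V ≃L[ℝ] V) : V →L[ℝ] V) 0 := by
    have := HasStrictFDerivAt.comp (g := Y) (g' := Y') (0:V) (by rw [hx]; exact hY) hinner
    rw [hcomp] at this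
    exact this
  have hG0 : Y (x + Rc 0) = Y x := by rw [hx]
  have h1 := hG.to_localInverse
  have h2 := hG.eventually_right_inverse
  have h3 := hG.localInverse_apply_image
  simp only [hG0] at h1 h2 h3
  refine ⟨fun y => x + Rc (hG.localInverse _ _ _ y), _, ?_,
    (Rc.hasStrictFDerivAt.comp _ h1).const_add x, h2⟩
  simp [h3]

lemma fderiv_comp_submersion {E V : Type*} [NormedAddCommGroup E] [NormedSpace ℝ E]
    [NormedAddCommGroup V] [NormedSpace ℝ V] [CompleteSpace V] [FiniteDimensional ℝ V]
    {Y : E → V} {Y' : E →L[ℝ] V} {x : E} (hY : HasStrictFDerivAt Y Y' x)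
    (hs : Function.Surjective Y') (F : V → ℝ) :
    fderiv ℝ (fun z => F (Y z)) x = (fderiv ℝ F (Y x)).comp Y' := by
  by_cases h : DifferentiableAt ℝ F (Y x)
  · exact (h.hasFDerivAt.comp x hY.hasFDerivAt).fderiv
  · rw [fderiv_zero_of_not_differentiableAt h, fderiv_zero_of_not_differentiableAt]
    · simp
    · intro hd
      apply h
      obtain ⟨σ, σ', h1, h2, h3⟩ := local_section hY hs
      have hd' : DifferentiableAt ℝ (fun z => F (Y z)) (σ (Y x)) := by rw [h1]; exact hd
      have := hd'.comp (Y x) h2.hasFDerivAt.differentiableAt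
      refine this.congr_of_eventuallyEq ?_
      filter_upwards [h3] with y hy
      simp [hy]

/-- Shift operator. -/
noncomputable def shiftN (R : ℕ) : (Fin (R+1) → ℝ) →L[ℝ] (Fin (R+1) → ℝ) :=
  ContinuousLinearMap.pi fun i =>
    if h : (i:ℕ) + 1 < R + 1 then ContinuousLinearMap.proj ⟨i + 1, h⟩ else 0

lemma shiftN_apply {R : ℕ} (y : Fin (R+1) → ℝ) (i : Fin (R+1)) (h : (i:ℕ)+1 < R+1) :
    shiftN R y i = y ⟨i+1, h⟩ := by
  rw [shiftN, ContinuousLinearMap.pi_apply, dif_pos h]; rfl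

lemma shiftN_apply' {R : ℕ} (y : Fin (R+1) → ℝ) (i : Fin (R+1)) (h : ¬ (i:ℕ)+1 < R+1) :
    shiftN R y i = 0 := by
  rw [shiftN, ContinuousLinearMap.pi_apply, dif_neg h]; rfl

/-- Unit vectors. -/
noncomputable def eV (R k : ℕ) : Fin (R+1) → ℝ := fun i => if (i:ℕ) = k then 1 else 0

lemma shiftN_eV {R k : ℕ} (hk : k + 1 ≤ R) : shiftN R (eV R (k+1)) = eV R k := by
  funext i
  by_cases h : (i:ℕ)+1 < R+1
  · rw [shiftN_apply _ _ h]; simp [eV]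
  · rw [shiftN_apply' _ _ h]; simp only [eV]; rw [if_neg (by omega)]

/-- The functions `ψ_k` in the coordinates `(b, L_f b, …)`. -/
noncomputable def FF (R : ℕ) (χ : ℝ → ℝ) (ξ : ℝ) (α : ℕ → ℝ → ℝ) : ℕ → (Fin (R+1) → ℝ) → ℝ
  | 0 => fun y => χ (y 0 / ξ)
  | k+1 => fun y => fderiv ℝ (FF R χ ξ α k) y (shiftN R y) + α (k+1) (FF R χ ξ α k y)

section
variable {R : ℕ} {χ : ℝ → ℝ} {ξ : ℝ} {α : ℕ → ℝ → ℝ}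

lemma fderiv_of_dep {F : (Fin (R+1) → ℝ) → ℝ} {k : ℕ}
    (hF : ∀ y z : Fin (R+1) → ℝ, (∀ i : Fin (R+1), (i:ℕ) ≤ k → y i = z i) → F y = F z)
    (y z : Fin (R+1) → ℝ) (h : ∀ i : Fin (R+1), (i:ℕ) ≤ k → y i = z i) :
    fderiv ℝ F y = fderiv ℝ F z := by
  have : (fun w => F (w + (z - y))) = F := by
    funext w
    apply hF
    intro i hi
    simp [h i hi]
  have h2 := fderiv_comp_add_right (𝕜 := ℝ) (f := F) (x := y) (z - y)
  rw [this] at h2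
  rw [h2]; simp

lemma fderiv_dep_zero {F : (Fin (R+1) → ℝ) → ℝ} {k : ℕ}
    (hF : ∀ y z : Fin (R+1) → ℝ, (∀ i : Fin (R+1), (i:ℕ) ≤ k → y i = z i) → F y = F z)
    (y w : Fin (R+1) → ℝ) (h : ∀ i : Fin (R+1), (i:ℕ) ≤ k → w i = 0) :
    fderiv ℝ F y w = 0 := by
  by_cases hd : DifferentiableAt ℝ F y
  · rw [← hd.lineDeriv_eq_fderiv, lineDeriv]
    have : (fun t : ℝ => F (y + t • w)) = fun _ => F y := by
      funext t
      apply hF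
      intro i hi
      simp [h i hi]
    rw [this]; simp
  · rw [fderiv_zero_of_not_differentiableAt hd]; simp

lemma FF_dep (k : ℕ) : ∀ y z : Fin (R+1) → ℝ, (∀ i : Fin (R+1), (i:ℕ) ≤ k → y i = z i) →
    FF R χ ξ α k y = FF R χ ξ α k z := by
  induction k with
  | zero => intro y z h; simp only [FF]; rw [h 0 (by simp)]
  | succ k ih =>
    intro y z h
    have h' : ∀ i : Fin (R+1), (i:ℕ) ≤ k → y i = z i := fun i hi => h i (by omega)
    simp only [FF]
    rw [ih y z h', fderiv_of_dep ih y z h']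
    congr 1
    rw [← sub_eq_zero, ← map_sub]
    apply fderiv_dep_zero ih
    intro i hi
    rw [Pi.sub_apply]
    by_cases hh : (i:ℕ)+1 < R+1
    · rw [shiftN_apply _ _ hh, shiftN_apply _ _ hh, h _ (by simpa using hi), sub_self]
    · rw [shiftN_apply' _ _ hh, shiftN_apply' _ _ hh, sub_self]

lemma FF_d_succ {k : ℕ} (hk : k + 1 ≤ R) (y : Fin (R+1) → ℝ)
    (hd : DifferentiableAt ℝ (FF R χ ξ α (k+1)) y) :
    fderiv ℝ (FF R χ ξ α (k+1)) y (eV R (k+1)) = fderiv ℝ (FF R χ ξ α k) y (eV R k) := by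
  rw [← hd.lineDeriv_eq_fderiv, lineDeriv]
  have : (fun t : ℝ => FF R χ ξ α (k+1) (y + t • eV R (k+1))) = fun t =>
      (fderiv ℝ (FF R χ ξ α k) y (shiftN R y) + t * fderiv ℝ (FF R χ ξ α k) y (eV R k)) +
        α (k+1) (FF R χ ξ α k y) := by
    funext t
    have hagree : ∀ i : Fin (R+1), (i:ℕ) ≤ k → (y + t • eV R (k+1)) i = y i := by
      intro i hi
      simp only [Pi.add_apply, Pi.smul_apply, eV]
      rw [if_neg (by omega)]; simp
    simp only [FF]
    rw [FF_dep k _ y hagree, fderiv_of_dep (FF_dep k) _ y hagree, map_add, map_add, map_smul,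
      map_smul, shiftN_eV hk, smul_eq_mul]
  rw [this]
  simp

lemma FF_zero_diff (hχ : Differentiable ℝ χ) (y : Fin (R+1) → ℝ) :
    HasFDerivAt (FF R χ ξ α 0) ((deriv χ (y 0 / ξ) / ξ) •
      (ContinuousLinearMap.proj 0 : (Fin (R+1) → ℝ) →L[ℝ] ℝ)) y := by
  have h1 : HasFDerivAt (fun y : Fin (R+1) → ℝ => y 0 / ξ)
    ((1/ξ) • (ContinuousLinearMap.proj 0 : (Fin (R+1) → ℝ) →L[ℝ] ℝ)) y := by
    have := ((ContinuousLinearMap.proj 0 : (Fin (R+1) → ℝ) →L[ℝ] ℝ).hasFDerivAt (x := y)).const_mul (1/ξ)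
    refine this.congr_of_eventuallyEq ?_
    filter_upwards with z
    simp; ring
  have := (hχ (y 0 / ξ)).hasDerivAt.comp_hasFDerivAt y h1
  rw [smul_smul] at this
  convert! this using 2
  ring

/-- Dichotomy. -/
lemma FF_key (hχ : Differentiable ℝ χ) (y : Fin (R+1) → ℝ) (k : ℕ) (hk : k ≤ R)
    (hne : fderiv ℝ (FF R χ ξ α k) y (eV R k) ≠ 0) :
    fderiv ℝ (FF R χ ξ α k) y (eV R k) = deriv χ (y 0 / ξ) / ξ ∧
    ∀ j ≤ k, DifferentiableAt ℝ (FF R χ ξ α j) y := by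
  induction k with
  | zero =>
    have := FF_zero_diff (R := R) (ξ := ξ) (α := α) hχ y
    refine ⟨by rw [this.fderiv]; simp [eV], ?_⟩
    intro j hj
    obtain rfl : j = 0 := by omega
    exact this.differentiableAt
  | succ k ih =>
    have hd : DifferentiableAt ℝ (FF R χ ξ α (k+1)) y := by
      by_contra hc
      rw [fderiv_zero_of_not_differentiableAt hc] at hne
      simp at hne
    rw [FF_d_succ hk y hd] at hne ⊢
    obtain ⟨h1, h2⟩ := ih (by omega) hne
    refine ⟨h1, fun j hj => ?_⟩
    rcases Nat.lt_or_ge j (k+1) with h | h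
    · exact h2 j (by omega)
    · obtain rfl : j = k+1 := by omega
      exact hd
end


/-- Lipschitz near a point. -/
def LipAt {A B : Type*} [PseudoEMetricSpace A] [PseudoEMetricSpace B] (φ : A → B) (x : A) : Prop :=
  ∃ K, ∃ t ∈ 𝓝 x, LipschitzOnWith K φ t

lemma LipAt.comp {A B C : Type*} [PseudoEMetricSpace A] [PseudoEMetricSpace B]
    [PseudoEMetricSpace C] {g : B → C} {φ : A → B} {x : A} (hg : LipAt g (φ x)) (hφ : LipAt φ x) :
    LipAt (fun z => g (φ z)) x := by
  obtain ⟨K1, t1, ht1, h1⟩ := hg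
  obtain ⟨K2, t2, ht2, h2⟩ := hφ
  have hc : ContinuousAt φ x := (h2.continuousOn).continuousAt ht2
  refine ⟨K1 * K2, t2 ∩ φ ⁻¹' t1, inter_mem ht2 (hc ht1), ?_⟩
  exact h1.comp (h2.mono inter_subset_left) (fun z hz => hz.2)

lemma LipAt.prodMk {A B C : Type*} [PseudoEMetricSpace A] [PseudoEMetricSpace B]
    [PseudoEMetricSpace C] {g : A → C} {φ : A → B} {x : A} (hφ : LipAt φ x) (hg : LipAt g x) :
    LipAt (fun z => (φ z, g z)) x := by
  obtain ⟨K1, t1, ht1, h1⟩ := hφ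
  obtain ⟨K2, t2, ht2, h2⟩ := hg
  refine ⟨max K1 K2, t1 ∩ t2, inter_mem ht1 ht2, ?_⟩
  exact (h1.mono inter_subset_left).prodMk (h2.mono inter_subset_right)

lemma LipAt.congr {A B : Type*} [PseudoEMetricSpace A] [PseudoEMetricSpace B]
    {g φ : A → B} {x : A} (hφ : LipAt φ x) (h : ∀ᶠ z in 𝓝 x, g z = φ z) : LipAt g x := by
  obtain ⟨K1, t1, ht1, h1⟩ := hφ
  refine ⟨K1, t1 ∩ {z | g z = φ z}, inter_mem ht1 h, ?_⟩
  intro a ha b hb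
  rw [ha.2, hb.2]
  exact h1 ha.1 hb.1

lemma LipAt.of_contDiffAt {A B : Type*} [NormedAddCommGroup A] [NormedSpace ℝ A]
    [NormedAddCommGroup B] [NormedSpace ℝ B] {φ : A → B} {x : A} (h : ContDiffAt ℝ 1 φ x) :
    LipAt φ x := h.exists_lipschitzOnWith

lemma LipAt.of_strict {A B : Type*} [NormedAddCommGroup A] [NormedSpace ℝ A]
    [NormedAddCommGroup B] [NormedSpace ℝ B] {φ : A → B} {φ' : A →L[ℝ] B} {x : A}
    (h : HasStrictFDerivAt φ φ' x) : LipAt φ x := h.exists_lipschitzOnWith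

lemma LipAt.of_lipschitz {A B : Type*} [PseudoEMetricSpace A] [PseudoEMetricSpace B]
    {φ : A → B} {x : A} {K} (h : LipschitzWith K φ) : LipAt φ x :=
  ⟨K, univ, univ_mem, h.lipschitzOnWith⟩

lemma LipAt.add {A B : Type*} [PseudoEMetricSpace A] [NormedAddCommGroup B] [NormedSpace ℝ B]
    {φ g : A → B} {x : A} (hφ : LipAt φ x) (hg : LipAt g x) : LipAt (fun z => φ z + g z) x :=
  LipAt.comp (g := fun p : B × B => p.1 + p.2) (LipAt.of_contDiffAt (by fun_prop)) (hφ.prodMk hg)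

lemma LipAt.sub {A B : Type*} [PseudoEMetricSpace A] [NormedAddCommGroup B] [NormedSpace ℝ B]
    {φ g : A → B} {x : A} (hφ : LipAt φ x) (hg : LipAt g x) : LipAt (fun z => φ z - g z) x :=
  LipAt.comp (g := fun p : B × B => p.1 - p.2) (LipAt.of_contDiffAt (by fun_prop)) (hφ.prodMk hg)

lemma LipAt.smul {A B : Type*} [PseudoEMetricSpace A] [NormedAddCommGroup B] [NormedSpace ℝ B]
    {φ : A → ℝ} {g : A → B} {x : A} (hφ : LipAt φ x) (hg : LipAt g x) :
    LipAt (fun z => φ z • g z) x :=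
  LipAt.comp (g := fun p : ℝ × B => p.1 • p.2) (LipAt.of_contDiffAt (by fun_prop)) (hφ.prodMk hg)

lemma LipAt.mul {A : Type*} [PseudoEMetricSpace A]
    {φ g : A → ℝ} {x : A} (hφ : LipAt φ x) (hg : LipAt g x) :
    LipAt (fun z => φ z * g z) x := hφ.smul hg

lemma LipAt.inv {A : Type*} [PseudoEMetricSpace A]
    {φ : A → ℝ} {x : A} (hφ : LipAt φ x) (h : φ x ≠ 0) :
    LipAt (fun z => (φ z)⁻¹) x :=
  LipAt.comp (g := fun p : ℝ => p⁻¹) (LipAt.of_contDiffAt (contDiffAt_inv ℝ h)) hφ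

lemma LipAt.clm_apply {A B C : Type*} [PseudoEMetricSpace A] [NormedAddCommGroup B] [NormedSpace ℝ B]
    [NormedAddCommGroup C] [NormedSpace ℝ C]
    {φ : A → B →L[ℝ] C} {g : A → B} {x : A} (hφ : LipAt φ x) (hg : LipAt g x) :
    LipAt (fun z => φ z (g z)) x :=
  LipAt.comp (g := fun p : (B →L[ℝ] C) × B => p.1 p.2) (LipAt.of_contDiffAt (by fun_prop)) (hφ.prodMk hg)

lemma LipAt.continuousAt {A B : Type*} [PseudoEMetricSpace A] [PseudoEMetricSpace B]
    {φ : A → B} {x : A} (h : LipAt φ x) : ContinuousAt φ x := by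
  obtain ⟨K, t, ht, h⟩ := h
  exact h.continuousOn.continuousAt ht

lemma expN_deriv {V : Type*} [NormedAddCommGroup V] [NormedSpace ℝ V] [CompleteSpace V]
    (N : V →L[ℝ] V) (t : ℝ) (z : V) :
    HasDerivAt (fun u : ℝ => NormedSpace.exp (u • N) z) (N (NormedSpace.exp (t • N) z)) t := by
  have h := hasDerivAt_exp_smul_const' (𝕂 := ℝ) N t
  exact h.clm_apply (hasDerivAt_const t z) |>.congr_deriv (by simp)

lemma core_bound {V : Type*} [NormedAddCommGroup V] [NormedSpace ℝ V] [FiniteDimensional ℝ V]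
    [CompleteSpace V] (N : V →L[ℝ] V) (e : V) {F : V → ℝ} {y1 : V}
    (hd : ∀ᶠ y in 𝓝 y1, DifferentiableAt ℝ F y) {C : ℝ}
    (hb : ∀ᶠ y in 𝓝 y1, ‖fderiv ℝ F y e‖ ≤ C)
    (hq : LipAt (fun y => fderiv ℝ F y (N y)) y1) :
    ∃ ρ' > 0, (∀ y ∈ Metric.ball y1 ρ', DifferentiableAt ℝ F y) ∧
      ∀ k, ∃ C', ∀ y ∈ Metric.ball y1 ρ', ‖fderiv ℝ F y ((N^k) e)‖ ≤ C' := by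
  obtain ⟨K, T, hT, hqT⟩ := hq
  obtain ⟨ρ, hρ, hall⟩ := Metric.eventually_nhds_iff_ball.1 (hd.and (hb.and hT))
  set P : ℝ → V →L[ℝ] V := fun t => NormedSpace.exp (t • N) with hP
  have hPc : Continuous P := by
    rw [continuous_iff_continuousAt]
    intro t
    exact (hasDerivAt_exp_smul_const' (𝕂 := ℝ) N t).continuousAt
  have hP0 : P 0 = 1 := by simp [hP]
  have hPadd : ∀ s t, P (s + t) = P s * P t := by
    intro s t
    simp only [hP, add_smul]
    let _ : NormedAlgebra ℚ (V →L[ℝ] V) := NormedAlgebra.restrictScalars ℚ ℝ _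
    exact NormedSpace.exp_add_of_commute (((Commute.refl N).smul_left s).smul_right t)
  have hjoint : ∀ᶠ p in 𝓝 (0:ℝ) ×ˢ 𝓝 y1, P p.1 p.2 ∈ Metric.ball y1 (ρ/2) := by
    rw [← nhds_prod_eq]
    have : Continuous fun p : ℝ × V => P p.1 p.2 := (hPc.comp continuous_fst).clm_apply continuous_snd
    refine this.continuousAt.eventually_mem ?_
    rw [hP0]
    exact Metric.ball_mem_nhds _ (by positivity)
  obtain ⟨A, hA⟩ := (isCompact_Icc (a := (-1:ℝ)) (b := 1)).exists_bound_of_continuousOn hPc.continuousOn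
  obtain ⟨pa, hpa, pb, hpb, hab⟩ := eventually_prod_iff.1 hjoint
  obtain ⟨δ1, hδ1, hb1⟩ := Metric.eventually_nhds_iff.1 hpa
  obtain ⟨ρ1, hρ1, hb2⟩ := Metric.eventually_nhds_iff_ball.1 hpb
  set δ := min δ1 1 with hδ
  have hδp : 0 < δ := lt_min hδ1 one_pos
  set ρ' := min ρ1 (ρ/2) with hρ'
  have hρ'p : 0 < ρ' := lt_min hρ1 (by positivity)
  have hin : ∀ t ∈ Ioo (-δ) δ, ∀ y ∈ Metric.ball y1 ρ', P t y ∈ Metric.ball y1 (ρ/2) := by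
    intro t ht y hy
    refine hab (hb1 ?_) (hb2 y (Metric.ball_subset_ball (min_le_left _ _) hy))
    rw [Real.dist_eq, sub_zero]
    exact (abs_lt.2 ht).trans_le (min_le_left _ _)
  have hAt : ∀ t ∈ Ioo (-δ) δ, ‖P t‖ ≤ A := by
    intro t ht
    have : δ ≤ 1 := min_le_right _ _
    exact hA t ⟨by linarith [ht.1], by linarith [ht.2]⟩
  have hA0 : 0 ≤ A := (norm_nonneg _).trans (hAt 0 ⟨by linarith, hδp⟩)
  have hC0 : 0 ≤ C := (norm_nonneg _).trans (hall y1 (Metric.mem_ball_self hρ)).2.1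
  -- main estimate
  have main : ∀ t ∈ Ioo (-δ) δ, ∀ y ∈ Metric.ball y1 ρ',
      ‖fderiv ℝ F y (P (-t) e)‖ ≤ C + K * (A * ‖P (-t) e‖) * |t| := by
    intro t ht y hy
    set w := P (-t) e with hw
    have hPw : P t w = e := by
      rw [hw, ← mul_apply_eq_comp, ← hPadd]; simp [hP0]
    have hyd : DifferentiableAt ℝ F y :=
      (hall y (Metric.ball_subset_ball ((min_le_right _ _).trans (by linarith)) hy)).1
    have hder : HasDerivAt (fun s : ℝ => F (y + s • w)) (fderiv ℝ F y w) 0 :=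
      hyd.hasFDerivAt.hasLineDerivAt w
    refine hder.le_of_lip' (by positivity) ?_
    have hsm : ∀ᶠ s in 𝓝 (0:ℝ), |s| * (A * ‖w‖) < ρ / 2 := by
      have : ContinuousAt (fun s : ℝ => |s| * (A * ‖w‖)) 0 := by fun_prop
      refine this.eventually_lt continuousAt_const ?_
      simp; positivity
    filter_upwards [hsm] with s hs
    have hnear : ∀ τ ∈ Ioo (-δ) δ, ∀ σ : ℝ, |σ| ≤ |s| → P τ y + σ • P τ w ∈ Metric.ball y1 ρ := by
      intro τ hτ σ hσ
      have h1 := hin τ hτ y hy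
      rw [mem_ball_iff_norm] at h1 ⊢
      have h2 : ‖σ • P τ w‖ ≤ |s| * (A * ‖w‖) := by
        rw [norm_smul]
        have : ‖P τ w‖ ≤ A * ‖w‖ := (P τ).le_of_opNorm_le (hAt τ hτ) w
        exact mul_le_mul hσ this (norm_nonneg _) (abs_nonneg _)
      calc ‖P τ y + σ • P τ w - y1‖ = ‖(P τ y - y1) + σ • P τ w‖ := by congr 1; abel
        _ ≤ _ := norm_add_le _ _
        _ < ρ := by linarith
    set g : ℝ → ℝ := fun τ => F (P τ (y + s • w)) - F (P τ y) with hg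
    have hexp : ∀ τ, P τ (y + s • w) = P τ y + s • P τ w := fun τ => by simp
    have hmem1 : ∀ τ ∈ Ioo (-δ) δ, P τ (y + s • w) ∈ Metric.ball y1 ρ := by
      intro τ hτ; rw [hexp]; exact hnear τ hτ s le_rfl
    have hmem2 : ∀ τ ∈ Ioo (-δ) δ, P τ y ∈ Metric.ball y1 ρ := by
      intro τ hτ; simpa using hnear τ hτ 0 (by simp)
    have hgd : ∀ τ ∈ Ioo (-δ) δ, HasDerivWithinAt g
        (fderiv ℝ F (P τ (y + s • w)) (N (P τ (y + s • w))) - fderiv ℝ F (P τ y) (N (P τ y)))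
        (Ioo (-δ) δ) τ := by
      intro τ hτ
      have a1 := (hall _ (hmem1 τ hτ)).1.hasFDerivAt.comp_hasDerivAt τ (expN_deriv N τ (y + s • w))
      have a2 := (hall _ (hmem2 τ hτ)).1.hasFDerivAt.comp_hasDerivAt τ (expN_deriv N τ y)
      exact (a1.sub a2).hasDerivWithinAt
    have hgb : ‖g 0 - g t‖ ≤ K * (|s| * (A * ‖w‖)) * ‖0 - t‖ := by
      refine (convex_Ioo (-δ) δ).norm_image_sub_le_of_norm_hasDerivWithin_le hgd ?_ ht ⟨by linarith, hδp⟩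
      intro τ hτ
      have := hqT.norm_sub_le (hall _ (hmem1 τ hτ)).2.2 (hall _ (hmem2 τ hτ)).2.2
      refine this.trans ?_
      gcongr
      rw [hexp, add_sub_cancel_left, norm_smul]
      have : ‖P τ w‖ ≤ A * ‖w‖ := (P τ).le_of_opNorm_le (hAt τ hτ) w
      exact mul_le_mul le_rfl this (norm_nonneg _) (abs_nonneg _)
    have hgt : ‖g t‖ ≤ C * |s| := by
      have hh := (convex_Icc (-|s|) |s|).norm_image_sub_le_of_norm_hasDerivWithin_le
        (f := fun σ : ℝ => F (P t y + σ • e)) (f' := fun σ => fderiv ℝ F (P t y + σ • e) e)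
        (C := C) (x := 0) (y := s) ?_ ?_ ⟨by simp, by simp⟩ ⟨neg_abs_le s, le_abs_self s⟩
      · simp only [hg, hexp, hPw]
        simpa using hh
      · intro σ hσ
        have hm := hnear t ht σ (abs_le.2 hσ)
        rw [hPw] at hm
        have l1 : HasDerivAt (fun σ : ℝ => P t y + σ • e) e σ := by
          simpa using ((hasDerivAt_id σ).smul_const e).const_add (P t y)
        exact ((hall _ hm).1.hasFDerivAt.comp_hasDerivAt σ l1).hasDerivWithinAt
      · intro σ hσ
        have hm := hnear t ht σ (abs_le.2 hσ)
        rw [hPw] at hm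
        exact (hall _ hm).2.1
    have hg0 : g 0 = F (y + s • w) - F y := by simp [hg, hP0]
    have : F (y + s • w) - F (y + (0:ℝ) • w) = g 0 := by rw [hg0]; simp
    rw [this]
    calc ‖g 0‖ = ‖(g 0 - g t) + g t‖ := by congr 1; ring
      _ ≤ ‖g 0 - g t‖ + ‖g t‖ := norm_add_le _ _
      _ ≤ K * (|s| * (A * ‖w‖)) * ‖0 - t‖ + C * |s| := add_le_add hgb hgt
      _ = (C + K * (A * ‖w‖) * |t|) * ‖s - 0‖ := by
        simp only [zero_sub, norm_neg, sub_zero, Real.norm_eq_abs]; ring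
  -- the subspace of bounded directions
  let S : Submodule ℝ V :=
    { carrier := {w | ∃ C', ∀ y ∈ Metric.ball y1 ρ', ‖fderiv ℝ F y w‖ ≤ C'}
      add_mem' := by
        rintro a b ⟨Ca, ha⟩ ⟨Cb, hb⟩
        refine ⟨Ca + Cb, fun y hy => ?_⟩
        rw [map_add]
        exact (norm_add_le _ _).trans (add_le_add (ha y hy) (hb y hy))
      zero_mem' := ⟨0, fun y hy => by simp⟩
      smul_mem' := by
        rintro c a ⟨Ca, ha⟩
        refine ⟨‖c‖ * Ca, fun y hy => ?_⟩
        rw [map_smul, norm_smul]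
        exact mul_le_mul_of_nonneg_left (ha y hy) (norm_nonneg _) }
  have hScl : IsClosed (S : Set V) := S.closed_of_finiteDimensional
  have hmemS : ∀ k, ∀ t ∈ Ioo (-δ) δ, (N^k) (P t e) ∈ S := by
    intro k
    induction k with
    | zero =>
      intro t ht
      refine ⟨C + K * (A * ‖P t e‖) * |t|, fun y hy => ?_⟩
      have := main (-t) ⟨by linarith [ht.2], by linarith [ht.1]⟩ y hy
      rw [neg_neg] at this
      simpa using this
    | succ k ih =>
      intro t ht
      have hder : HasDerivAt (fun u : ℝ => (N^k) (P u e)) ((N^k) (N (P t e))) t :=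
        (N^k).hasFDerivAt.comp_hasDerivAt t (expN_deriv N t e)
      rw [pow_succ, mul_apply_eq_comp]
      refine hScl.mem_of_tendsto (hasDerivAt_iff_tendsto_slope.1 hder) ?_
      filter_upwards [mem_nhdsWithin_of_mem_nhds (Ioo_mem_nhds ht.1 ht.2)] with u hu
      rw [slope_def_module]
      exact S.smul_mem _ (S.sub_mem (ih u hu) (ih t ht))
  refine ⟨ρ', hρ'p, fun y hy => (hall y (Metric.ball_subset_ball ((min_le_right _ _).trans (by linarith)) hy)).1, ?_⟩
  intro k
  have := hmemS k 0 ⟨by linarith, hδp⟩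
  rw [hP0] at this
  exact this

lemma shiftN_pow {R : ℕ} (k : ℕ) (hk : k ≤ R) : ((shiftN R)^k) (eV R R) = eV R (R - k) := by
  induction k with
  | zero => simp
  | succ k ih =>
    rw [pow_succ', mul_apply_eq_comp, ih (by omega)]
    have : R - k = (R - (k+1)) + 1 := by omega
    rw [this, shiftN_eV (by omega)]

lemma core_lip {R : ℕ} {F : (Fin (R+1) → ℝ) → ℝ} {y1 : Fin (R+1) → ℝ}
    (hd : ∀ᶠ y in 𝓝 y1, DifferentiableAt ℝ F y) {C : ℝ}
    (hb : ∀ᶠ y in 𝓝 y1, ‖fderiv ℝ F y (eV R R)‖ ≤ C)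
    (hq : LipAt (fun y => fderiv ℝ F y (shiftN R y)) y1) : LipAt F y1 := by
  obtain ⟨ρ, hρ, hd', hk⟩ := core_bound (shiftN R) (eV R R) hd hb hq
  have hj : ∀ j : Fin (R+1), ∃ C', ∀ y ∈ Metric.ball y1 ρ, ‖fderiv ℝ F y (eV R j)‖ ≤ C' := by
    intro j
    have := hk (R - j)
    rwa [shiftN_pow _ (by omega), show R - (R - (j:ℕ)) = j by omega] at this
  choose c hc using hj
  have hc0 : ∀ j, 0 ≤ c j := fun j => (norm_nonneg _).trans (hc j y1 (Metric.mem_ball_self hρ))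
  have hn : ∀ y ∈ Metric.ball y1 ρ, ‖fderiv ℝ F y‖ ≤ ∑ j, c j := by
    intro y hy
    refine ContinuousLinearMap.opNorm_le_bound _ (Finset.sum_nonneg fun j _ => hc0 j) ?_
    intro v
    have h1 := LinearMap.pi_apply_eq_sum_univ (fderiv ℝ F y : (Fin (R+1) → ℝ) →ₗ[ℝ] ℝ) v
    have h2 : fderiv ℝ F y v = ∑ i, v i • fderiv ℝ F y (eV R i) := by
      refine h1.trans (Finset.sum_congr rfl fun i _ => ?_)
      have h3 : (fun j : Fin (R+1) => if i = j then (1:ℝ) else 0) = eV R i := by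
        funext j
        simp only [eV, Fin.ext_iff, eq_comm]
      rw [h3]
      rfl
    rw [h2, Finset.sum_mul]
    refine (norm_sum_le _ _).trans (Finset.sum_le_sum fun i _ => ?_)
    rw [norm_smul, mul_comm]
    exact mul_le_mul (hc i y hy) (norm_le_pi_norm v i) (norm_nonneg _) (hc0 i)
  refine ⟨⟨∑ j, c j, Finset.sum_nonneg fun j _ => hc0 j⟩, _, Metric.ball_mem_nhds y1 hρ, ?_⟩
  exact (convex_ball y1 ρ).lipschitzOnWith_of_nnnorm_fderiv_le hd' (fun y hy => hn y hy)


section LieStuff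
variable {n : ℕ}

lemma lieD_smooth {f : EuclideanSpace ℝ (Fin n) → EuclideanSpace ℝ (Fin n)}
    (hf : ContDiff ℝ (⊤ : ℕ∞) f) {φ : EuclideanSpace ℝ (Fin n) → ℝ}
    (hφ : ContDiff ℝ (⊤ : ℕ∞) φ) : ContDiff ℝ (⊤ : ℕ∞) (LieD f φ) :=
  (hφ.fderiv_right (m := (⊤ : ℕ∞)) (by exact_mod_cast le_rfl)).clm_apply hf

lemma lieIter_smooth {f : EuclideanSpace ℝ (Fin n) → EuclideanSpace ℝ (Fin n)}
    (hf : ContDiff ℝ (⊤ : ℕ∞) f) {b : EuclideanSpace ℝ (Fin n) → ℝ}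
    (hb : ContDiff ℝ (⊤ : ℕ∞) b) (k : ℕ) : ContDiff ℝ (⊤ : ℕ∞) ((LieD f)^[k] b) := by
  induction k with
  | zero => exact hb
  | succ k ih => rw [Function.iterate_succ_apply']; exact lieD_smooth hf ih

/-- Iterated brackets. -/
noncomputable def XX (f X0 : EuclideanSpace ℝ (Fin n) → EuclideanSpace ℝ (Fin n)) :
    ℕ → EuclideanSpace ℝ (Fin n) → EuclideanSpace ℝ (Fin n)
  | 0 => X0
  | k+1 => fun x => fderiv ℝ (XX f X0 k) x (f x) - fderiv ℝ f x (XX f X0 k x)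

lemma XX_smooth {f X0 : EuclideanSpace ℝ (Fin n) → EuclideanSpace ℝ (Fin n)}
    (hf : ContDiff ℝ (⊤ : ℕ∞) f) (hX : ContDiff ℝ (⊤ : ℕ∞) X0) (k : ℕ) :
    ContDiff ℝ (⊤ : ℕ∞) (XX f X0 k) := by
  induction k with
  | zero => exact hX
  | succ k ih =>
    exact ((ih.fderiv_right (m := (⊤ : ℕ∞)) (by exact_mod_cast le_rfl)).clm_apply hf).sub
      ((hf.fderiv_right (m := (⊤ : ℕ∞)) (by exact_mod_cast le_rfl)).clm_apply ih)

lemma bracket_id {f X : EuclideanSpace ℝ (Fin n) → EuclideanSpace ℝ (Fin n)}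
    (hf : ContDiff ℝ (⊤ : ℕ∞) f) (hX : ContDiff ℝ (⊤ : ℕ∞) X)
    {φ : EuclideanSpace ℝ (Fin n) → ℝ}
    (hφ : ContDiff ℝ (⊤ : ℕ∞) φ) (x : EuclideanSpace ℝ (Fin n)) :
    fderiv ℝ φ x (fderiv ℝ X x (f x) - fderiv ℝ f x (X x)) =
      fderiv ℝ (fun z => fderiv ℝ φ z (X z)) x (f x) - fderiv ℝ (LieD f φ) x (X x) := by
  have h1 : ∀ Z : EuclideanSpace ℝ (Fin n) → EuclideanSpace ℝ (Fin n), ContDiff ℝ (⊤ : ℕ∞) Z →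
      ∀ v, fderiv ℝ (fun z => fderiv ℝ φ z (Z z)) x v =
        fderiv ℝ (fderiv ℝ φ) x v (Z x) + fderiv ℝ φ x (fderiv ℝ Z x v) := by
    intro Z hZ v
    have hd : DifferentiableAt ℝ (fderiv ℝ φ) x :=
      ((hφ.fderiv_right (m := (⊤ : ℕ∞)) (by exact_mod_cast le_rfl)).differentiable (by simp)) x
    have hZd : DifferentiableAt ℝ Z x := (hZ.differentiable (by simp)) x
    rw [fderiv_clm_apply hd hZd]
    simp [add_comm]
  have hs : IsSymmSndFDerivAt ℝ φ x := by
    refine hφ.contDiffAt.isSymmSndFDerivAt ?_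
    rw [minSmoothness_of_isRCLikeNormedField]
    exact WithTop.coe_le_coe.2 (le_top : (2:ℕ∞) ≤ ⊤)
  have h2 := h1 X hX (f x)
  have h3 := h1 f hf (X x)
  unfold LieD
  rw [h2, h3, map_sub, hs (f x) (X x)]
  ring

lemma XX_lie {f X0 : EuclideanSpace ℝ (Fin n) → EuclideanSpace ℝ (Fin n)}
    (hf : ContDiff ℝ (⊤ : ℕ∞) f) (hX : ContDiff ℝ (⊤ : ℕ∞) X0)
    {b : EuclideanSpace ℝ (Fin n) → ℝ}
    (hb : ContDiff ℝ (⊤ : ℕ∞) b) {D : Set (EuclideanSpace ℝ (Fin n))} (hD : IsOpen D) {R : ℕ}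
    (h0 : ∀ i < R, ∀ x ∈ D, fderiv ℝ ((LieD f)^[i] b) x (X0 x) = 0) (k : ℕ) :
    ∀ i, (i + k < R → ∀ x ∈ D, fderiv ℝ ((LieD f)^[i] b) x (XX f X0 k x) = 0) ∧
      (i + k = R → ∀ x ∈ D, fderiv ℝ ((LieD f)^[i] b) x (XX f X0 k x) =
        (-1)^k * fderiv ℝ ((LieD f)^[R] b) x (X0 x)) := by
  induction k with
  | zero =>
    intro i
    refine ⟨fun hi x hx => h0 i (by omega) x hx, fun hi x hx => ?_⟩
    obtain rfl : i = R := by omega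
    simp [XX]
  | succ k ih =>
    intro i
    have key : i + k < R → ∀ x ∈ D, fderiv ℝ ((LieD f)^[i] b) x (XX f X0 (k+1) x) =
        - fderiv ℝ ((LieD f)^[i+1] b) x (XX f X0 k x) := by
      intro hi x hx
      have h1 := bracket_id hf (XX_smooth hf hX k) (lieIter_smooth hf hb i) x
      have h2 : (fun z => fderiv ℝ ((LieD f)^[i] b) z (XX f X0 k z)) =ᶠ[𝓝 x] fun _ => (0:ℝ) := by
        filter_upwards [hD.mem_nhds hx] with z hz using (ih i).1 hi z hz
      rw [h2.fderiv_eq] at h1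
      rw [Function.iterate_succ_apply']
      simpa [XX] using h1
    refine ⟨fun hi x hx => ?_, fun hi x hx => ?_⟩
    · rw [key (by omega) x hx, (ih (i+1)).1 (by omega) x hx, neg_zero]
    · rw [key (by omega) x hx, (ih (i+1)).2 (by omega) x hx, pow_succ]; ring

/-- The output coordinates. -/
noncomputable def YY (f : EuclideanSpace ℝ (Fin n) → EuclideanSpace ℝ (Fin n))
    (b : EuclideanSpace ℝ (Fin n) → ℝ) (R : ℕ) (x : EuclideanSpace ℝ (Fin n)) : Fin (R+1) → ℝ :=
  fun i => (LieD f)^[(i:ℕ)] b x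

lemma YY_smooth {f : EuclideanSpace ℝ (Fin n) → EuclideanSpace ℝ (Fin n)}
    (hf : ContDiff ℝ (⊤ : ℕ∞) f) {b : EuclideanSpace ℝ (Fin n) → ℝ}
    (hb : ContDiff ℝ (⊤ : ℕ∞) b) (R : ℕ) : ContDiff ℝ (⊤ : ℕ∞) (YY f b R) :=
  contDiff_pi.2 fun i => lieIter_smooth hf hb i

lemma YY_fderiv {f : EuclideanSpace ℝ (Fin n) → EuclideanSpace ℝ (Fin n)}
    (hf : ContDiff ℝ (⊤ : ℕ∞) f) {b : EuclideanSpace ℝ (Fin n) → ℝ}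
    (hb : ContDiff ℝ (⊤ : ℕ∞) b) (R : ℕ) (x v : EuclideanSpace ℝ (Fin n)) (i : Fin (R+1)) :
    fderiv ℝ (YY f b R) x v i = fderiv ℝ ((LieD f)^[(i:ℕ)] b) x v := by
  have : HasFDerivAt (YY f b R) (ContinuousLinearMap.pi fun i : Fin (R+1) =>
      fderiv ℝ ((LieD f)^[(i:ℕ)] b) x) x :=
    hasFDerivAt_pi.2 fun i =>
      (((lieIter_smooth hf hb i).differentiable (by simp)) x).hasFDerivAt
  rw [this.fderiv]; rfl

lemma YY_surj {f X0 : EuclideanSpace ℝ (Fin n) → EuclideanSpace ℝ (Fin n)}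
    (hf : ContDiff ℝ (⊤ : ℕ∞) f) (hX : ContDiff ℝ (⊤ : ℕ∞) X0)
    {b : EuclideanSpace ℝ (Fin n) → ℝ}
    (hb : ContDiff ℝ (⊤ : ℕ∞) b) {D : Set (EuclideanSpace ℝ (Fin n))} (hD : IsOpen D) {R : ℕ}
    (h0 : ∀ i < R, ∀ x ∈ D, fderiv ℝ ((LieD f)^[i] b) x (X0 x) = 0)
    {x : EuclideanSpace ℝ (Fin n)} (hx : x ∈ D)
    (hne : fderiv ℝ ((LieD f)^[R] b) x (X0 x) ≠ 0) :
    Function.Surjective (fderiv ℝ (YY f b R) x) := by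
  by_contra hns
  have hlt : LinearMap.range (fderiv ℝ (YY f b R) x : EuclideanSpace ℝ (Fin n) →ₗ[ℝ] (Fin (R+1) → ℝ)) < ⊤ := by
    rw [lt_top_iff_ne_top]
    intro h
    exact hns (LinearMap.range_eq_top.1 h)
  obtain ⟨l, hl0, hl⟩ := Submodule.exists_le_ker_of_lt_top _ hlt
  have hsum : ∀ w : Fin (R+1) → ℝ, l w = ∑ i, w i * l (eV R i) := by
    intro w
    refine (LinearMap.pi_apply_eq_sum_univ l w).trans (Finset.sum_congr rfl fun i _ => ?_)
    have h3 : (fun j : Fin (R+1) => if i = j then (1:ℝ) else 0) = eV R i := by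
      funext j
      simp only [eV, Fin.ext_iff, eq_comm]
    rw [h3, smul_eq_mul]
  have hz : ∀ v, ∑ i : Fin (R+1), fderiv ℝ ((LieD f)^[(i:ℕ)] b) x v * l (eV R i) = 0 := by
    intro v
    have h1 : l (fderiv ℝ (YY f b R) x v) = 0 := hl ⟨v, rfl⟩
    rw [hsum] at h1
    simpa only [YY_fderiv hf hb] using h1
  have hc : ∀ k, k ≤ R → l (eV R (R - k)) = 0 := by
    intro k
    induction k using Nat.strong_induction_on with
    | _ k ih =>
      intro hk
      have h1 := hz (XX f X0 k x)
      rw [Finset.sum_eq_single (⟨R - k, by omega⟩ : Fin (R+1))] at h1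
      · simp only at h1
        rw [(XX_lie hf hX hb hD h0 k (R - k)).2 (by omega) x hx] at h1
        rcases mul_eq_zero.1 h1 with h2 | h2
        · exfalso
          rcases mul_eq_zero.1 h2 with h3 | h3
          · exact absurd h3 (pow_ne_zero _ (by norm_num))
          · exact hne h3
        · exact h2
      · intro i _ hi
        have hi' : (i:ℕ) ≠ R - k := fun h => hi (Fin.ext h)
        have hiR : (i:ℕ) < R + 1 := i.2
        rcases Nat.lt_or_ge (i:ℕ) (R - k) with h | h
        · rw [(XX_lie hf hX hb hD h0 k i).1 (by omega) x hx, zero_mul]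
        · have := ih (R - i) (by omega) (by omega)
          rw [show R - (R - (i:ℕ)) = i by omega] at this
          rw [this, mul_zero]
      · simp
  apply hl0
  ext w
  simp only [LinearMap.comp_apply, LinearMap.zero_apply]
  rw [hsum]
  refine Finset.sum_eq_zero fun i _ => ?_
  have := hc (R - i) (by omega)
  have hiR : (i:ℕ) < R + 1 := i.2
  rw [show R - (R - (i:ℕ)) = i by omega] at this
  rw [this, mul_zero]

end LieStuff


/-- The standing assumptions, with `r = R + 1`. -/
structure SF {n m : ℕ} (R : ℕ) (f : EuclideanSpace ℝ (Fin n) → EuclideanSpace ℝ (Fin n))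
    (g : EuclideanSpace ℝ (Fin n) → (EuclideanSpace ℝ (Fin m) →L[ℝ] EuclideanSpace ℝ (Fin n)))
    (b : EuclideanSpace ℝ (Fin n) → ℝ) (D : Set (EuclideanSpace ℝ (Fin n))) (ξ : ℝ)
    (χ : ℝ → ℝ) (α : ℕ → ℝ → ℝ) (ψ : ℕ → EuclideanSpace ℝ (Fin n) → ℝ) : Prop where
  hf : ContDiff ℝ (⊤ : ℕ∞) f
  hg : ContDiff ℝ (⊤ : ℕ∞) g
  hb : ContDiff ℝ (⊤ : ℕ∞) b
  hD : IsOpen D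
  hrel : ∀ i < R, ∀ x ∈ D, ∀ u, fderiv ℝ ((LieD f)^[i] b) x (g x u) = 0
  hξ : 0 < ξ
  hE : ∀ x ∈ D, b x < ξ → ∃ u, fderiv ℝ ((LieD f)^[R] b) x (g x u) ≠ 0
  hχ : ContDiff ℝ (R + 1 : ℕ) χ
  hχ1 : ∀ τ : ℝ, 1 ≤ τ → χ τ = 1
  hχd : ∀ τ : ℝ, τ < 1 → 0 < deriv χ τ
  hα : ∀ k, 1 ≤ k → k ≤ R + 1 → ContDiff ℝ 1 (α k) ∧ StrictMono (α k) ∧ α k 0 = 0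
  hψ0 : ∀ x, ψ 0 x = χ (b x / ξ)
  hψ : ∀ k < R, ∀ x, ψ (k + 1) x = LieD f (ψ k) x + α (k + 1) (ψ k x)
  hLg : LocallyLipschitzOn D (fun x => (fderiv ℝ (ψ R) x).comp (g x))
  hLf : LocallyLipschitzOn D (LieD f (ψ R))

namespace SF
variable {n m R : ℕ} {f : EuclideanSpace ℝ (Fin n) → EuclideanSpace ℝ (Fin n)}
  {g : EuclideanSpace ℝ (Fin n) → (EuclideanSpace ℝ (Fin m) →L[ℝ] EuclideanSpace ℝ (Fin n))}
  {b : EuclideanSpace ℝ (Fin n) → ℝ} {D : Set (EuclideanSpace ℝ (Fin n))} {ξ : ℝ}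
  {χ : ℝ → ℝ} {α : ℕ → ℝ → ℝ} {ψ : ℕ → EuclideanSpace ℝ (Fin n) → ℝ}

lemma χdiff (S : SF R f g b D ξ χ α ψ) : Differentiable ℝ χ :=
  S.hχ.differentiable (by simp)

lemma bcont (S : SF R f g b D ξ χ α ψ) : Continuous b := S.hb.continuous

lemma surj (S : SF R f g b D ξ χ α ψ) {x : EuclideanSpace ℝ (Fin n)} (hx : x ∈ D) (hbx : b x < ξ) :
    Function.Surjective (fderiv ℝ (YY f b R) x) := by
  obtain ⟨u, hu⟩ := S.hE x hx hbx
  exact YY_surj (X0 := fun z => g z u) S.hf (S.hg.clm_apply contDiff_const) S.hb S.hD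
    (fun i hi z hz => S.hrel i hi z hz u) hx hu

lemma Ystrict (S : SF R f g b D ξ χ α ψ) (x : EuclideanSpace ℝ (Fin n)) :
    HasStrictFDerivAt (YY f b R) (fderiv ℝ (YY f b R) x) x :=
  (YY_smooth S.hf S.hb R).contDiffAt.hasStrictFDerivAt (by simp)

lemma U_nhds (S : SF R f g b D ξ χ α ψ) {x : EuclideanSpace ℝ (Fin n)} (hx : x ∈ D)
    (hbx : b x < ξ) : ∀ᶠ z in 𝓝 x, z ∈ D ∧ b z < ξ :=
  (S.hD.eventually_mem hx).and (S.bcont.continuousAt.eventually_lt continuousAt_const hbx)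

lemma Yf (S : SF R f g b D ξ χ α ψ) (x : EuclideanSpace ℝ (Fin n)) :
    fderiv ℝ (YY f b R) x (f x) =
      shiftN R (YY f b R x) + ((LieD f)^[R+1] b x) • eV R R := by
  funext i
  rw [YY_fderiv S.hf S.hb, Pi.add_apply, Pi.smul_apply, smul_eq_mul]
  by_cases h : (i:ℕ) + 1 < R + 1
  · rw [shiftN_apply _ _ h]
    simp only [eV, YY]
    rw [if_neg (by omega), Function.iterate_succ_apply']
    simp [LieD]
  · rw [shiftN_apply' _ _ h]
    have : (i:ℕ) = R := by omega
    simp only [eV]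
    rw [if_pos this, this, Function.iterate_succ_apply']
    simp [LieD]

lemma Yg (S : SF R f g b D ξ χ α ψ) {x : EuclideanSpace ℝ (Fin n)} (hx : x ∈ D)
    (u : EuclideanSpace ℝ (Fin m)) :
    fderiv ℝ (YY f b R) x (g x u) = (fderiv ℝ ((LieD f)^[R] b) x (g x u)) • eV R R := by
  funext i
  rw [YY_fderiv S.hf S.hb, Pi.smul_apply, smul_eq_mul]
  by_cases h : (i:ℕ) = R
  · simp [eV, h]
  · simp only [eV]
    rw [if_neg h, mul_zero, S.hrel i (by omega) x hx]

lemma psi_eq (S : SF R f g b D ξ χ α ψ) (k : ℕ) (hk : k ≤ R) :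
    ∀ x ∈ D, b x < ξ → ψ k x = FF R χ ξ α k (YY f b R x) := by
  induction k with
  | zero => intro x _ _; rw [S.hψ0]; rfl
  | succ k ih =>
    intro x hx hbx
    have hev : ψ k =ᶠ[𝓝 x] fun z => FF R χ ξ α k (YY f b R z) := by
      filter_upwards [S.U_nhds hx hbx] with z hz using ih (by omega) z hz.1 hz.2
    rw [S.hψ k (by omega), LieD, hev.fderiv_eq,
      fderiv_comp_submersion (S.Ystrict x) (S.surj hx hbx), ih (by omega) x hx hbx]
    simp only [FF]
    congr 1
    rw [ContinuousLinearMap.comp_apply, S.Yf, map_add]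
    rw [fderiv_dep_zero (FF_dep k) _ (((LieD f)^[R+1] b x) • eV R R), add_zero]
    intro i hi
    simp only [Pi.smul_apply, eV]
    rw [if_neg (by omega), smul_zero]

lemma fderiv_psi (S : SF R f g b D ξ χ α ψ) {x : EuclideanSpace ℝ (Fin n)} (hx : x ∈ D)
    (hbx : b x < ξ) (k : ℕ) (hk : k ≤ R) :
    fderiv ℝ (ψ k) x = (fderiv ℝ (FF R χ ξ α k) (YY f b R x)).comp (fderiv ℝ (YY f b R) x) := by
  have hev : ψ k =ᶠ[𝓝 x] fun z => FF R χ ξ α k (YY f b R z) := by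
    filter_upwards [S.U_nhds hx hbx] with z hz using S.psi_eq k hk z hz.1 hz.2
  rw [hev.fderiv_eq, fderiv_comp_submersion (S.Ystrict x) (S.surj hx hbx)]

lemma Lg_eq (S : SF R f g b D ξ χ α ψ) {x : EuclideanSpace ℝ (Fin n)} (hx : x ∈ D)
    (hbx : b x < ξ) (u : EuclideanSpace ℝ (Fin m)) :
    fderiv ℝ (ψ R) x (g x u) = fderiv ℝ (FF R χ ξ α R) (YY f b R x) (eV R R) *
      fderiv ℝ ((LieD f)^[R] b) x (g x u) := by
  rw [S.fderiv_psi hx hbx R le_rfl, ContinuousLinearMap.comp_apply, S.Yg hx, map_smul, smul_eq_mul,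
    mul_comm]

lemma Lf_eq (S : SF R f g b D ξ χ α ψ) {x : EuclideanSpace ℝ (Fin n)} (hx : x ∈ D)
    (hbx : b x < ξ) :
    LieD f (ψ R) x = fderiv ℝ (FF R χ ξ α R) (YY f b R x) (shiftN R (YY f b R x)) +
      (LieD f)^[R+1] b x * fderiv ℝ (FF R χ ξ α R) (YY f b R x) (eV R R) := by
  rw [LieD, S.fderiv_psi hx hbx R le_rfl, ContinuousLinearMap.comp_apply, S.Yf, map_add, map_smul,
    smul_eq_mul]

lemma G_d (S : SF R f g b D ξ χ α ψ) {x : EuclideanSpace ℝ (Fin n)} (hx : x ∈ D)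
    (hbx : b x < ξ) (hne : (fderiv ℝ (ψ R) x).comp (g x) ≠ 0) :
    fderiv ℝ (FF R χ ξ α R) (YY f b R x) (eV R R) ≠ 0 := by
  intro h
  apply hne
  ext u
  simpa [h] using S.Lg_eq hx hbx u

lemma G_key (S : SF R f g b D ξ χ α ψ) {x : EuclideanSpace ℝ (Fin n)} (hx : x ∈ D)
    (hbx : b x < ξ) (hne : (fderiv ℝ (ψ R) x).comp (g x) ≠ 0) :
    fderiv ℝ (FF R χ ξ α R) (YY f b R x) (eV R R) = deriv χ (b x / ξ) / ξ ∧
    ∀ j ≤ R, DifferentiableAt ℝ (FF R χ ξ α j) (YY f b R x) :=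
  FF_key S.χdiff _ R le_rfl (S.G_d hx hbx hne)

lemma G_diff (S : SF R f g b D ξ χ α ψ) {x : EuclideanSpace ℝ (Fin n)} (hx : x ∈ D)
    (hbx : b x < ξ) (hne : (fderiv ℝ (ψ R) x).comp (g x) ≠ 0) (j : ℕ) (hj : j ≤ R) :
    DifferentiableAt ℝ (ψ j) x := by
  have hev : ψ j =ᶠ[𝓝 x] fun z => FF R χ ξ α j (YY f b R z) := by
    filter_upwards [S.U_nhds hx hbx] with z hz using S.psi_eq j hj z hz.1 hz.2
  refine DifferentiableAt.congr_of_eventuallyEq ?_ hev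
  exact ((S.G_key hx hbx hne).2 j hj).comp x (S.Ystrict x).hasFDerivAt.differentiableAt

lemma lip_at {B : Type*} [PseudoEMetricSpace B] {φ : EuclideanSpace ℝ (Fin n) → B} (hD : IsOpen D)
    (h : LocallyLipschitzOn D φ) {x : EuclideanSpace ℝ (Fin n)} (hx : x ∈ D) : LipAt φ x := by
  obtain ⟨K, t, ht, h⟩ := h hx
  rw [hD.nhdsWithin_eq hx] at ht
  exact ⟨K, t, ht, h⟩

lemma Lg_cont (S : SF R f g b D ξ χ α ψ) {x : EuclideanSpace ℝ (Fin n)} (hx : x ∈ D) :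
    ContinuousAt (fun x => (fderiv ℝ (ψ R) x).comp (g x)) x :=
  (lip_at S.hD S.hLg hx).continuousAt

lemma Bcont (S : SF R f g b D ξ χ α ψ) :
    Continuous (fun x => (fderiv ℝ ((LieD f)^[R] b) x).comp (g x)) :=
  ((lieIter_smooth S.hf S.hb R).continuous_fderiv (by simp)).clm_comp S.hg.continuous

lemma Lg_clm (S : SF R f g b D ξ χ α ψ) {x : EuclideanSpace ℝ (Fin n)} (hx : x ∈ D)
    (hbx : b x < ξ) :
    (fderiv ℝ (ψ R) x).comp (g x) = (fderiv ℝ (FF R χ ξ α R) (YY f b R x) (eV R R)) •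
      (fderiv ℝ ((LieD f)^[R] b) x).comp (g x) := by
  ext1 u
  exact S.Lg_eq hx hbx u

lemma dχ1 (S : SF R f g b D ξ χ α ψ) : deriv χ 1 = 0 := by
  have h := (S.χdiff 1).hasDerivAt.hasDerivWithinAt (s := Ici 1)
  have h2 : HasDerivWithinAt χ 0 (Ici 1) 1 :=
    (hasDerivWithinAt_const (1:ℝ) (Ici 1) (1:ℝ)).congr (fun y hy => S.hχ1 y hy) (S.hχ1 1 le_rfl)
  exact (uniqueDiffOn_Ici (1:ℝ) 1 self_mem_Ici).eq_deriv _ h h2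

lemma dχcont (S : SF R f g b D ξ χ α ψ) : Continuous (deriv χ) :=
  S.hχ.continuous_deriv (by simp)

lemma Lg_zero (S : SF R f g b D ξ χ α ψ) {x : EuclideanSpace ℝ (Fin n)} (hx : x ∈ D)
    (hbx : ξ ≤ b x) : (fderiv ℝ (ψ R) x).comp (g x) = 0 := by
  have hξ := S.hξ
  by_cases hcl : ∃ᶠ z in 𝓝 x, b z < ξ
  · have hbξ : b x = ξ := by
      by_contra hne
      have hlt : ξ < b x := lt_of_le_of_ne hbx (Ne.symm hne)
      have : ∀ᶠ z in 𝓝 x, ξ < b z := continuousAt_const.eventually_lt S.bcont.continuousAt hlt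
      exact hcl (this.mono fun z hz => not_lt.2 hz.le)
    by_contra hne
    have hpos : 0 < ‖(fderiv ℝ (ψ R) x).comp (g x)‖ := norm_pos_iff.2 hne
    have h1 := (S.Lg_cont hx).norm
    have h2 : ContinuousAt (fun z => |deriv χ (b z / ξ) / ξ| *
        ‖(fderiv ℝ ((LieD f)^[R] b) z).comp (g z)‖) x := by
      have hc : Continuous (fun z => deriv χ (b z / ξ)) :=
        S.dχcont.comp (S.bcont.div_const ξ)
      exact ((hc.div_const ξ).abs.mul S.Bcont.norm).continuousAt
    have h3 : ∀ᶠ z in 𝓝 x, |deriv χ (b z / ξ) / ξ| *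
        ‖(fderiv ℝ ((LieD f)^[R] b) z).comp (g z)‖ < ‖(fderiv ℝ (ψ R) z).comp (g z)‖ := by
      refine h2.eventually_lt h1 ?_
      rw [hbξ, div_self hξ.ne', S.dχ1]
      simpa using hpos
    obtain ⟨z, hz1, hz2, hz3⟩ := (hcl.and_eventually (h3.and (S.hD.eventually_mem hx))).exists
    have hzne : (fderiv ℝ (ψ R) z).comp (g z) ≠ 0 := by
      intro h0
      rw [h0, norm_zero] at hz2
      exact absurd hz2 (not_lt.2 (by positivity))
    rw [S.Lg_clm hz3 hz1, (S.G_key hz3 hz1 hzne).1, norm_smul, Real.norm_eq_abs] at hz2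
    exact lt_irrefl _ hz2
  · have hev : ∀ᶠ z in 𝓝 x, ξ ≤ b z :=
      (Filter.not_frequently.1 hcl).mono fun z hz => not_lt.1 hz
    have hconst : ∀ k ≤ R, ∃ c : ℝ, ψ k =ᶠ[𝓝 x] fun _ => c := by
      intro k
      induction k with
      | zero =>
        intro _
        refine ⟨1, ?_⟩
        filter_upwards [hev] with z hz
        rw [S.hψ0]
        exact S.hχ1 _ ((one_le_div hξ).2 hz)
      | succ k ih =>
        intro hk
        obtain ⟨c, hc⟩ := ih (by omega)
        refine ⟨α (k+1) c, ?_⟩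
        filter_upwards [hc.eventuallyEq_nhds, hc] with z hz hz'
        rw [S.hψ k (by omega), LieD, hz.fderiv_eq, hz']
        simp
    obtain ⟨c, hc⟩ := hconst R le_rfl
    rw [hc.fderiv_eq]
    simp

lemma G_lt (S : SF R f g b D ξ χ α ψ) {x : EuclideanSpace ℝ (Fin n)} (hx : x ∈ D)
    (hne : (fderiv ℝ (ψ R) x).comp (g x) ≠ 0) : b x < ξ := by
  by_contra h
  exact hne (S.Lg_zero hx (not_lt.1 h))

/-- Interior points with vanishing gain. -/
lemma Lg_zero_near (S : SF R f g b D ξ χ α ψ) {x : EuclideanSpace ℝ (Fin n)} (hx : x ∈ D)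
    (hbx : b x < ξ) (h0 : (fderiv ℝ (ψ R) x).comp (g x) = 0) :
    ∀ᶠ z in 𝓝 x, (fderiv ℝ (ψ R) z).comp (g z) = 0 := by
  have hξ := S.hξ
  obtain ⟨u, hu⟩ := S.hE x hx hbx
  have hBpos : 0 < ‖(fderiv ℝ ((LieD f)^[R] b) x).comp (g x)‖ := by
    refine norm_pos_iff.2 fun h => hu ?_
    exact congrArg (fun l : EuclideanSpace ℝ (Fin m) →L[ℝ] ℝ => l u) h
  have h1 := (S.Lg_cont hx).norm
  have h2 : ContinuousAt (fun z => |deriv χ (b z / ξ) / ξ| *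
      ‖(fderiv ℝ ((LieD f)^[R] b) z).comp (g z)‖) x := by
    have hc : Continuous (fun z => deriv χ (b z / ξ)) :=
      S.dχcont.comp (S.bcont.div_const ξ)
    exact ((hc.div_const ξ).abs.mul S.Bcont.norm).continuousAt
  have hd : 0 < deriv χ (b x / ξ) := S.hχd _ ((div_lt_one hξ).2 hbx)
  have h3 : ∀ᶠ z in 𝓝 x, ‖(fderiv ℝ (ψ R) z).comp (g z)‖ < |deriv χ (b z / ξ) / ξ| *
      ‖(fderiv ℝ ((LieD f)^[R] b) z).comp (g z)‖ := by
    refine h1.eventually_lt h2 ?_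
    rw [h0, norm_zero]
    positivity
  filter_upwards [h3, S.U_nhds hx hbx] with z hz hzU
  by_contra hzne
  rw [S.Lg_clm hzU.1 hzU.2, (S.G_key hzU.1 hzU.2 hzne).1, norm_smul, Real.norm_eq_abs] at hz
  exact lt_irrefl _ hz

end SF


namespace SF
variable {n m R : ℕ} {f : EuclideanSpace ℝ (Fin n) → EuclideanSpace ℝ (Fin n)}
  {g : EuclideanSpace ℝ (Fin n) → (EuclideanSpace ℝ (Fin m) →L[ℝ] EuclideanSpace ℝ (Fin n))}
  {b : EuclideanSpace ℝ (Fin n) → ℝ} {D : Set (EuclideanSpace ℝ (Fin n))} {ξ : ℝ}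
  {χ : ℝ → ℝ} {α : ℕ → ℝ → ℝ} {ψ : ℕ → EuclideanSpace ℝ (Fin n) → ℝ}

lemma psi_lip (S : SF R f g b D ξ χ α ψ) {x : EuclideanSpace ℝ (Fin n)} (hx : x ∈ D)
    (hne : (fderiv ℝ (ψ R) x).comp (g x) ≠ 0) : LipAt (ψ R) x := by
  have hbx := S.G_lt hx hne
  obtain ⟨u0, hu0⟩ := S.hE x hx hbx
  obtain ⟨σ, σ', hσ1, hσ2, hσ3⟩ := local_section (S.Ystrict x) (S.surj hx hbx)
  set y1 := YY f b R x with hy1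
  have hσl : LipAt σ y1 := LipAt.of_strict hσ2
  have hσc : Tendsto σ (𝓝 y1) (𝓝 x) := by
    have := hσl.continuousAt
    rwa [ContinuousAt, hσ1] at this
  have hG : ∀ᶠ z in 𝓝 x, (z ∈ D ∧ b z < ξ) ∧ (fderiv ℝ (ψ R) z).comp (g z) ≠ 0 ∧
      (fderiv ℝ ((LieD f)^[R] b) z).comp (g z) u0 ≠ 0 := by
    refine (S.U_nhds hx hbx).and (((S.Lg_cont hx).eventually_ne hne).and ?_)
    have : Continuous fun z => (fderiv ℝ ((LieD f)^[R] b) z).comp (g z) u0 :=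
      S.Bcont.clm_apply continuous_const
    exact this.continuousAt.eventually_ne hu0
  have hGσ := hσc.eventually hG
  -- the gain in output coordinates
  have hdlip : LipAt (fun y => fderiv ℝ (FF R χ ξ α R) y (eV R R)) y1 := by
    have l1 : LipAt (fun z => (fderiv ℝ (ψ R) z).comp (g z) u0) x :=
      (lip_at S.hD S.hLg hx).clm_apply (LipAt.of_contDiffAt contDiffAt_const)
    have hBs : ContDiff ℝ 1 (fun z => (fderiv ℝ ((LieD f)^[R] b) z).comp (g z) u0) := by
      have := (((lieIter_smooth S.hf S.hb R).fderiv_right (m := (⊤ : ℕ∞))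
        (by exact_mod_cast le_rfl)).clm_comp S.hg).clm_apply
        (contDiff_const (c := u0))
      exact this.of_le (by exact_mod_cast le_top)
    have l2 : LipAt (fun z => (fderiv ℝ ((LieD f)^[R] b) z).comp (g z) u0) x :=
      LipAt.of_contDiffAt hBs.contDiffAt
    have l3 := l1.mul (l2.inv hu0)
    have l4 := LipAt.comp (φ := σ) (x := y1) (by rw [hσ1]; exact l3) hσl
    refine l4.congr ?_
    filter_upwards [hGσ, hσ3] with y hy hYσ
    have e1 := S.Lg_eq hy.1.1 hy.1.2 u0
    rw [hYσ] at e1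
    have e2 := hy.2.2
    simp only [ContinuousLinearMap.comp_apply] at e2 ⊢
    rw [e1]
    field_simp
  have hq : LipAt (fun y => fderiv ℝ (FF R χ ξ α R) y (shiftN R y)) y1 := by
    have l1 : LipAt (LieD f (ψ R)) x := lip_at S.hD S.hLf hx
    have l2 : LipAt ((LieD f)^[R+1] b) x := LipAt.of_contDiffAt
      (((lieIter_smooth S.hf S.hb (R+1)).of_le (by exact_mod_cast le_top)).contDiffAt)
    have l3 := LipAt.comp (φ := σ) (x := y1) (by rw [hσ1]; exact l1) hσl
    have l4 := LipAt.comp (φ := σ) (x := y1) (by rw [hσ1]; exact l2) hσl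
    refine (l3.sub (l4.mul hdlip)).congr ?_
    filter_upwards [hGσ, hσ3] with y hy hYσ
    have e1 := S.Lf_eq hy.1.1 hy.1.2
    rw [hYσ] at e1
    rw [e1]; ring
  have hd : ∀ᶠ y in 𝓝 y1, DifferentiableAt ℝ (FF R χ ξ α R) y := by
    filter_upwards [hGσ, hσ3] with y hy hYσ
    have := (S.G_key hy.1.1 hy.1.2 hy.2.1).2 R le_rfl
    rwa [hYσ] at this
  have hbd : ∀ᶠ y in 𝓝 y1, ‖fderiv ℝ (FF R χ ξ α R) y (eV R R)‖ ≤
      ‖fderiv ℝ (FF R χ ξ α R) y1 (eV R R)‖ + 1 := by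
    have := hdlip.continuousAt.norm.eventually_lt
      (continuousAt_const (y := ‖fderiv ℝ (FF R χ ξ α R) y1 (eV R R)‖ + 1)) (by simp)
    exact this.mono fun y hy => hy.le
  have hF := core_lip hd hbd hq
  have hl : LipAt (fun z => FF R χ ξ α R (YY f b R z)) x :=
    LipAt.comp hF (LipAt.of_strict (S.Ystrict x))
  refine hl.congr ?_
  filter_upwards [S.U_nhds hx hbx] with z hz using S.psi_eq R le_rfl z hz.1 hz.2

/-- Regular points. -/
lemma u_lip_regular (S : SF R f g b D ξ χ α ψ) {x : EuclideanSpace ℝ (Fin n)} (hx : x ∈ D)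
    (hne : (fderiv ℝ (ψ R) x).comp (g x) ≠ 0)
    {unom u : EuclideanSpace ℝ (Fin n) → EuclideanSpace ℝ (Fin m)}
    (hun : LocallyLipschitzOn D unom) {μ : EuclideanSpace ℝ (Fin n) → ℝ}
    (hμ : ∀ x ∈ D, μ x =
      if 0 ≤ fderiv ℝ (ψ R) x (g x (unom x)) + α (R+1) (ψ R x) + LieD f (ψ R) x
      then 0
      else -(fderiv ℝ (ψ R) x (g x (unom x)) + α (R+1) (ψ R x) + LieD f (ψ R) x)
           / ‖(fderiv ℝ (ψ R) x).comp (g x)‖ ^ 2)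
    (hu : ∀ x ∈ D, u x = unom x + μ x •
      (InnerProductSpace.toDual ℝ (EuclideanSpace ℝ (Fin m))).symm
        ((fderiv ℝ (ψ R) x).comp (g x))) : LipAt u x := by
  have lun := lip_at S.hD hun hx
  have lLg := lip_at S.hD S.hLg hx
  have lLf := lip_at S.hD S.hLf hx
  have lα : LipAt (fun z => α (R+1) (ψ R z)) x :=
    LipAt.comp (LipAt.of_contDiffAt (S.hα (R+1) (by omega) le_rfl).1.contDiffAt) (S.psi_lip hx hne)
  have lc := ((lLg.clm_apply lun).add lα).add lLf
  have lmin := LipAt.comp (g := fun t : ℝ => min t 0)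
    (LipAt.of_lipschitz (LipschitzWith.id.min_const 0)) lc
  have ln : LipAt (fun z => ‖(fderiv ℝ (ψ R) z).comp (g z)‖) x :=
    LipAt.comp (g := fun l : EuclideanSpace ℝ (Fin m) →L[ℝ] ℝ => ‖l‖)
      (LipAt.of_lipschitz lipschitzWith_one_norm) lLg
  have ln2 := (ln.mul ln).inv (mul_ne_zero (norm_ne_zero_iff.2 hne) (norm_ne_zero_iff.2 hne))
  have lD : LipAt (fun z => (InnerProductSpace.toDual ℝ (EuclideanSpace ℝ (Fin m))).symm
        ((fderiv ℝ (ψ R) z).comp (g z))) x :=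
    LipAt.comp (LipAt.of_lipschitz
      (InnerProductSpace.toDual ℝ (EuclideanSpace ℝ (Fin m))).symm.lipschitz) lLg
  refine (lun.sub ((lmin.mul ln2).smul lD)).congr ?_
  filter_upwards [S.hD.mem_nhds hx] with z hz
  rw [hu z hz, hμ z hz, sub_eq_add_neg, ← neg_smul]
  congr 2
  simp only [ContinuousLinearMap.comp_apply]
  split_ifs with h
  · rw [min_eq_right h]; simp
  · rw [min_eq_left (not_le.1 h).le]; rw [← sq]; ring

end SF


/-- Equilibrium values. -/
noncomputable def cc (α : ℕ → ℝ → ℝ) : ℕ → ℝ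
  | 0 => 1
  | k+1 => α (k+1) (cc α k)

namespace SF
variable {n m R : ℕ} {f : EuclideanSpace ℝ (Fin n) → EuclideanSpace ℝ (Fin n)}
  {g : EuclideanSpace ℝ (Fin n) → (EuclideanSpace ℝ (Fin m) →L[ℝ] EuclideanSpace ℝ (Fin n))}
  {b : EuclideanSpace ℝ (Fin n) → ℝ} {D : Set (EuclideanSpace ℝ (Fin n))} {ξ : ℝ}
  {χ : ℝ → ℝ} {α : ℕ → ℝ → ℝ} {ψ : ℕ → EuclideanSpace ℝ (Fin n) → ℝ}

lemma cc_pos (S : SF R f g b D ξ χ α ψ) (k : ℕ) (hk : k ≤ R + 1) : 0 < cc α k := by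
  induction k with
  | zero => simp [cc]
  | succ k ih =>
    obtain ⟨_, h2, h3⟩ := S.hα (k+1) (by omega) hk
    have := h2 (ih (by omega))
    rw [h3] at this
    exact this

lemma descend (S : SF R f g b D ξ χ α ψ) (K lam : ℝ) (hK : 0 < K) (hlam : 0 < lam)
    (hlam1 : lam ≤ 1) (p : ℕ) (j : ℕ) (hj : j ≤ R) :
    ∃ K' > 0, ∃ lam' > 0, lam' ≤ 1 ∧ ∀ T, 0 < T → T ≤ 1 → ∀ e : ℕ → ℝ → ℝ,
      (∀ k < R, ∀ t ∈ Icc 0 T, HasDerivAt (e k)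
        (e (k+1) t - (α (k+1) (cc α k + e k t) - α (k+1) (cc α k))) t) →
      BigOn (e R) T K lam p → BigOn (e (R - j)) T K' lam' (p + j) := by
  induction j with
  | zero => exact ⟨K, hK, lam, hlam, hlam1, fun T _ _ e _ h => h⟩
  | succ j ih =>
    obtain ⟨K1, hK1, l1, hl1, hl11, h1⟩ := ih (by omega)
    obtain ⟨ha1, ha2, _⟩ := S.hα (R - (j+1) + 1) (by omega) (by omega)
    obtain ⟨K2, hK2, h2⟩ := bigOn_step_alpha ha1 ha2 (cc α (R - (j+1))) K1 l1 hK1 hl1 hl11 (p+j)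
    refine ⟨K2, hK2, l1/4, by positivity, by linarith, fun T hT hT1 e he hB => ?_⟩
    have h3 := h1 T hT hT1 e he hB
    refine h2 T hT hT1 (e (R-(j+1))) (e (R - j)) (fun t ht => ?_) h3
    have := he (R - (j+1)) (by omega) t ht
    rwa [show R - (j+1) + 1 = R - j by omega] at this ⊢

lemma traj (S : SF R f g b D ξ χ α ψ) {x0 : EuclideanSpace ℝ (Fin n)} (hb0 : b x0 = ξ)
    {ρ Lb : ℝ} (hρ : 0 < ρ) (hρD : Metric.ball x0 ρ ⊆ D) (hLb : 0 ≤ Lb)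
    (hL : ∀ z ∈ Metric.ball x0 ρ, |LieD f b z| ≤ Lb) {δ0 : ℝ} (hδ0 : 0 < δ0) :
    ∀ᶠ x in 𝓝 x0, (fderiv ℝ (ψ R) x).comp (g x) ≠ 0 → ∃ T, 0 < T ∧ T ≤ δ0 ∧
      ∃ γ : ℝ → EuclideanSpace ℝ (Fin n), γ 0 = x ∧ ∀ t ∈ Icc 0 T, HasDerivAt γ (f (γ t)) t ∧
        γ t ∈ Metric.ball x0 ρ ∧ (fderiv ℝ (ψ R) (γ t)).comp (g (γ t)) ≠ 0 ∧
        |b (γ t) - ξ| ≤ (2 * Lb + 1) * T := by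
  obtain ⟨δ1, hδ1, ρ', hρ', htr⟩ := local_traj (f := f) (x0 := x0)
    (S.hf.contDiffAt.of_le (by exact_mod_cast le_top)) hρ
  set δ := min δ0 δ1 with hδ
  have hδp : 0 < δ := lt_min hδ0 hδ1
  have hbc : ∀ᶠ x in 𝓝 x0, |b x - ξ| < δ := by
    have : ContinuousAt (fun x => |b x - ξ|) x0 := (S.bcont.sub continuous_const).abs.continuousAt
    exact this.eventually_lt continuousAt_const (by simp [hb0, hδp])
  filter_upwards [Metric.ball_mem_nhds x0 hρ', hbc] with x hx hbx hne
  obtain ⟨γ, hγ0, hγ⟩ := htr x hx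
  have hγ' : ∀ t ∈ Icc 0 δ, HasDerivAt γ (f (γ t)) t ∧ γ t ∈ Metric.ball x0 ρ := fun t ht =>
    hγ t ⟨ht.1, ht.2.trans (min_le_right _ _)⟩
  have hbl : ∀ s ∈ Icc 0 δ, ∀ t ∈ Icc 0 δ, |b (γ t) - b (γ s)| ≤ Lb * |t - s| := by
    intro s hs t ht
    refine (convex_Icc (0:ℝ) δ).norm_image_sub_le_of_norm_hasDerivWithin_le
      (f := fun t => b (γ t)) (f' := fun t => LieD f b (γ t)) (fun z hz => ?_)
      (fun z hz => hL _ (hγ' z hz).2) hs ht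
    have hbd : HasFDerivAt b (fderiv ℝ b (γ z)) (γ z) :=
      (S.hb.differentiable (by simp) (γ z)).hasFDerivAt
    exact (hbd.comp_hasDerivAt z (hγ' z hz).1).hasDerivWithinAt
  have hcont : ContinuousOn (fun t => (fderiv ℝ (ψ R) (γ t)).comp (g (γ t))) (Icc 0 δ) := by
    intro t ht
    have h1 := S.Lg_cont (hρD (hγ' t ht).2)
    exact (ContinuousAt.comp (f := γ) h1 (hγ' t ht).1.continuousAt).continuousWithinAt
  by_cases hZ : ∃ t ∈ Icc 0 δ, (fderiv ℝ (ψ R) (γ t)).comp (g (γ t)) = 0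
  · set Z := Icc 0 δ ∩ (fun t => (fderiv ℝ (ψ R) (γ t)).comp (g (γ t))) ⁻¹' {0} with hZdef
    have hZc : IsClosed Z := hcont.preimage_isClosed_of_isClosed isClosed_Icc isClosed_singleton
    have hZk : IsCompact Z := isCompact_Icc.of_isClosed_subset hZc inter_subset_left
    obtain ⟨τ, hτZ, hτmin⟩ := hZk.exists_isLeast (by obtain ⟨t, h1, h2⟩ := hZ; exact ⟨t, h1, h2⟩)
    have hτ0 : (fderiv ℝ (ψ R) (γ τ)).comp (g (γ τ)) = 0 := hτZ.2
    have hτp : 0 < τ := by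
      refine lt_of_le_of_ne hτZ.1.1 fun h => hne ?_
      rw [← h, hγ0] at hτ0
      exact hτ0
    have hbefore : ∀ t, 0 ≤ t → t < τ → (fderiv ℝ (ψ R) (γ t)).comp (g (γ t)) ≠ 0 := by
      intro t h0 ht h
      exact absurd (hτmin ⟨⟨h0, ht.le.trans hτZ.1.2⟩, h⟩) (not_le.2 ht)
    have hbτ : ξ ≤ b (γ τ) := by
      by_contra hlt
      have h1 := S.Lg_zero_near (hρD (hγ' τ hτZ.1).2) (not_le.1 hlt) hτ0
      have h2 := (hγ' τ hτZ.1).1.continuousAt.eventually h1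
      have h3 : ∀ᶠ t in 𝓝[<] τ, t ∈ Ioo 0 τ := Ioo_mem_nhdsLT hτp
      obtain ⟨t, ht1, ht2⟩ := ((h2.filter_mono nhdsWithin_le_nhds).and h3).exists
      exact hbefore t ht2.1.le ht2.2 ht1
    refine ⟨τ/2, by positivity, ?_, γ, hγ0, fun t ht => ?_⟩
    · have : δ ≤ δ0 := min_le_left _ _
      linarith [hτZ.1.2]
    · have htI : t ∈ Icc 0 δ := ⟨ht.1, by linarith [ht.2, hτZ.1.2]⟩
      have htne := hbefore t ht.1 (by linarith [ht.2])
      have hlt := S.G_lt (hρD (hγ' t htI).2) htne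
      refine ⟨(hγ' t htI).1, (hγ' t htI).2, htne, ?_⟩
      have h1 := hbl t htI τ hτZ.1
      have h2 : |τ - t| ≤ τ := by rw [abs_of_nonneg] <;> linarith [ht.1, ht.2]
      have h3 : b (γ τ) - b (γ t) ≤ Lb * τ :=
        (le_abs_self _).trans (h1.trans (mul_le_mul_of_nonneg_left h2 hLb))
      rw [abs_of_neg (by linarith)]
      linarith
  · push Not at hZ
    refine ⟨δ, hδp, min_le_left _ _, γ, hγ0, fun t ht => ⟨(hγ' t ht).1, (hγ' t ht).2, hZ t ht, ?_⟩⟩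
    have h1 := hbl 0 ⟨le_rfl, hδp.le⟩ t ht
    rw [hγ0, sub_zero, abs_of_nonneg ht.1] at h1
    have h2 : Lb * t ≤ Lb * δ := mul_le_mul_of_nonneg_left ht.2 hLb
    calc |b (γ t) - ξ| = |(b (γ t) - b x) + (b x - ξ)| := by congr 1; ring
      _ ≤ |b (γ t) - b x| + |b x - ξ| := abs_add_le _ _
      _ ≤ Lb * δ + δ := by linarith
      _ ≤ _ := by nlinarith

lemma bigOn_abs {e : ℝ → ℝ} {T K lam : ℝ} {p : ℕ} (hT : 0 < T) (hlam : 0 < lam)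
    (h : BigOn e T K lam p) : ∃ t ∈ Icc 0 T, K * T ^ p ≤ |e t| := by
  obtain ⟨s, hs0, hsT, h⟩ := h
  have hp : 0 < lam * T := by positivity
  refine ⟨s, ⟨hs0, by linarith⟩, ?_⟩
  rcases h with h | h
  · exact (h s ⟨le_rfl, by linarith⟩).trans (le_abs_self _)
  · have := h s ⟨le_rfl, by linarith⟩
    linarith [neg_le_abs (e s)]

lemma singular (S : SF R f g b D ξ χ α ψ) {x0 : EuclideanSpace ℝ (Fin n)} (hx0 : x0 ∈ D)
    (hb0 : b x0 = ξ) {unom : EuclideanSpace ℝ (Fin n) → EuclideanSpace ℝ (Fin m)}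
    (hun : ∃ M : ℝ, ∀ x ∈ D, ‖unom x‖ ≤ M) :
    ∀ᶠ x in 𝓝 x0, (fderiv ℝ (ψ R) x).comp (g x) ≠ 0 →
      0 ≤ fderiv ℝ (ψ R) x (g x (unom x)) + α (R+1) (ψ R x) + LieD f (ψ R) x := by
  obtain ⟨M, hM⟩ := hun
  have hξ := S.hξ
  set cr := cc α (R+1) with hcr
  have hcrp : 0 < cr := S.cc_pos (R+1) le_rfl
  obtain ⟨hα1, hα2, _⟩ := S.hα (R+1) (by omega) le_rfl
  obtain ⟨ε, hε, hεα⟩ : ∃ ε > 0, 3 * cr / 4 ≤ α (R+1) (cc α R - ε) := by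
    have hc : ContinuousAt (fun e => α (R+1) (cc α R - e)) 0 :=
      (hα1.continuous.comp (continuous_const.sub continuous_id)).continuousAt
    have h1 : ∀ᶠ e in 𝓝 (0:ℝ), 3 * cr / 4 < α (R+1) (cc α R - e) := by
      refine continuousAt_const.eventually_lt hc ?_
      rw [sub_zero]
      have : cr = α (R+1) (cc α R) := rfl
      linarith
    have h2 : ∀ᶠ e in 𝓝[>] (0:ℝ), e ∈ Ioi (0:ℝ) := self_mem_nhdsWithin
    obtain ⟨e, he1, he2⟩ := ((h1.filter_mono nhdsWithin_le_nhds).and h2).exists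
    exact ⟨e, he2, he1.le⟩
  -- constants for both cases
  obtain ⟨K1, hK1, l1, hl1, _, hA⟩ := S.descend (ε/2) 1 (by positivity) one_pos le_rfl 1 R le_rfl
  obtain ⟨K2, hK2, hB0⟩ := bigOn_step (φ := fun _ => 0) 1 le_rfl (fun e h _ => by simpa using h)
    (fun e h _ => by simpa using h) (fun _ _ => le_rfl) (fun _ _ => le_rfl) (cr/4) 1 (by positivity)
    one_pos le_rfl 0
  obtain ⟨K3, hK3, l3, hl3, _, hB⟩ := S.descend K2 (1/4) hK2 (by norm_num) (by norm_num) 1 R le_rfl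
  set K := min K1 K3 with hK
  have hKp : 0 < K := lt_min hK1 hK3
  set Lb := |LieD f b x0| + 1 with hLb
  have hLbp : 0 ≤ Lb := by positivity
  set C := (2 * Lb + 1) / ξ with hC
  have hCp : 0 < C := by positivity
  set η := K / (2 * C ^ (R+1)) with hη
  have hηp : 0 < η := by positivity
  set M' := |LieD f (ψ R) x0| + cr with hM'
  have hM'p : 0 < M' := by positivity
  -- neighbourhood
  have e1 : ∀ᶠ z in 𝓝 x0, ‖(fderiv ℝ (ψ R) z).comp (g z)‖ * (|M| + 1) < cr / 4 := by
    refine ((S.Lg_cont hx0).norm.mul continuousAt_const).eventually_lt continuousAt_const ?_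
    simp only [Pi.mul_apply]
    rw [S.Lg_zero hx0 hb0.ge]
    simpa using hcrp
  have e2 : ∀ᶠ z in 𝓝 x0, |LieD f (ψ R) z - LieD f (ψ R) x0| < cr / 8 := by
    have h1 := (lip_at S.hD S.hLf hx0).continuousAt
    have h2 : ContinuousAt (fun z => |LieD f (ψ R) z - LieD f (ψ R) x0|) x0 :=
      (h1.sub continuousAt_const).abs
    exact h2.eventually_lt continuousAt_const (by simpa using hcrp)
  have e3 : ∀ᶠ z in 𝓝 x0, |LieD f b z| < Lb := by
    have h1 : ContinuousAt (LieD f b) x0 := (lieD_smooth S.hf S.hb).continuous.continuousAt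
    exact h1.abs.eventually_lt continuousAt_const (by simp [hLb])
  have e4 : ∀ᶠ z in 𝓝 x0, |χ (b z / ξ) - 1| ≤ η * |b z / ξ - 1| ^ (R+1) := by
    have h1 := (chi_flat S.hχ S.hχ1).def hηp
    have h2 : Tendsto (fun z => b z / ξ) (𝓝 x0) (𝓝 1) := by
      have := (S.bcont.div_const ξ).tendsto x0
      rwa [hb0, div_self hξ.ne'] at this
    filter_upwards [h2.eventually h1] with z hz
    simpa [abs_pow] using hz
  obtain ⟨ρ, hρ, hall⟩ := Metric.eventually_nhds_iff_ball.1
    ((S.hD.eventually_mem hx0).and (e1.and (e2.and (e3.and e4))))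
  set δ0 := min 1 (ε / (2 * M')) with hδ0
  have hδ0p : 0 < δ0 := by positivity
  filter_upwards [S.traj hb0 hρ (fun z hz => (hall z hz).1) hLbp
    (fun z hz => (hall z hz).2.2.2.1.le) hδ0p] with x hx hne
  obtain ⟨T, hT, hTδ, γ, hγ0, hγ⟩ := hx hne
  have hT1 : T ≤ 1 := hTδ.trans (min_le_left _ _)
  by_contra hneg
  rw [not_le] at hneg
  have hxball : x ∈ Metric.ball x0 ρ := by rw [← hγ0]; exact (hγ 0 ⟨le_rfl, hT.le⟩).2.1
  have hLu : |fderiv ℝ (ψ R) x (g x (unom x))| ≤ cr / 4 := by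
    have h1 := ((fderiv ℝ (ψ R) x).comp (g x)).le_opNorm (unom x)
    have h2 : ‖unom x‖ ≤ |M| + 1 := (hM x (hall x hxball).1).trans (by linarith [le_abs_self M])
    exact (h1.trans (mul_le_mul_of_nonneg_left h2 (norm_nonneg _))).trans (hall x hxball).2.1.le
  have hlow := (abs_le.1 hLu).1
  -- trajectories of the errors
  set e : ℕ → ℝ → ℝ := fun k t => ψ k (γ t) - cc α k with he
  have hder : ∀ k ≤ R, ∀ t ∈ Icc 0 T, HasDerivAt (e k) (LieD f (ψ k) (γ t)) t := by
    intro k hk t ht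
    obtain ⟨h1, h2, h3, _⟩ := hγ t ht
    have hD := (hall _ h2).1
    have := (S.G_diff hD (S.G_lt hD h3) h3 k hk).hasFDerivAt.comp_hasDerivAt t h1
    exact this.sub_const _
  have hode : ∀ k < R, ∀ t ∈ Icc 0 T, HasDerivAt (e k)
      (e (k+1) t - (α (k+1) (cc α k + e k t) - α (k+1) (cc α k))) t := by
    intro k hk t ht
    refine (hder k hk.le t ht).congr_deriv ?_
    simp only [he]
    rw [S.hψ k hk, add_sub_cancel]
    simp only [cc]
    ring
  have hℓ : ∀ t ∈ Icc 0 T, |LieD f (ψ R) (γ t) - LieD f (ψ R) x0| < cr / 8 := fun t ht =>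
    (hall _ (hγ t ht).2.1).2.2.1
  have hfin : ∀ K' l', 0 < l' → K ≤ K' → BigOn (e 0) T K' l' (R+1) → False := by
    intro K' l' hl' hKK hBig
    obtain ⟨t, ht, hbig⟩ := bigOn_abs hT hl' hBig
    obtain ⟨_, h2, _, h4⟩ := hγ t ht
    have h5 := (hall _ h2).2.2.2.2
    have h6 : |b (γ t) / ξ - 1| ≤ C * T := by
      have : b (γ t) / ξ - 1 = (b (γ t) - ξ) / ξ := by field_simp
      rw [this, abs_div, abs_of_pos hξ, hC, div_mul_eq_mul_div]
      exact div_le_div_of_nonneg_right h4 hξ.le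
    have h7 : |b (γ t) / ξ - 1| ^ (R+1) ≤ (C * T) ^ (R+1) :=
      pow_le_pow_left₀ (abs_nonneg _) h6 _
    have h8 : |e 0 t| ≤ η * (C * T) ^ (R+1) := by
      simp only [he, S.hψ0, cc]
      exact h5.trans (mul_le_mul_of_nonneg_left h7 hηp.le)
    have h9 : η * (C * T) ^ (R+1) = K / 2 * T ^ (R+1) := by
      rw [mul_pow, hη]; field_simp
    have hTp : 0 < T ^ (R+1) := by positivity
    have h10 : K * T ^ (R+1) ≤ K' * T ^ (R+1) := mul_le_mul_of_nonneg_right hKK hTp.le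
    nlinarith
  by_cases hcase : ψ R x ≤ cc α R - ε
  · -- case A
    have hBR : BigOn (e R) T (ε/2) 1 1 := by
      refine ⟨0, le_rfl, by simp, Or.inr fun t ht => ?_⟩
      have ht' : t ∈ Icc 0 T := by simpa using ht
      have h1 := (convex_Icc (0:ℝ) T).norm_image_sub_le_of_norm_hasDerivWithin_le
        (f := e R) (f' := fun t => LieD f (ψ R) (γ t)) (C := M')
        (fun z hz => (hder R le_rfl z hz).hasDerivWithinAt) (fun z hz => ?_)
        (⟨le_rfl, hT.le⟩ : (0:ℝ) ∈ Icc 0 T) ht'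
      · rw [Real.norm_eq_abs, Real.norm_eq_abs, sub_zero, abs_of_nonneg ht'.1] at h1
        have h2 := (le_abs_self _).trans h1
        have h3 : e R 0 ≤ -ε := by simp only [he, hγ0]; linarith
        have h4 : M' * t ≤ M' * (ε / (2 * M')) :=
          mul_le_mul_of_nonneg_left (ht'.2.trans (hTδ.trans (min_le_right _ _))) hM'p.le
        have h5 : M' * (ε / (2 * M')) = ε / 2 := by field_simp
        have h6 : ε / 2 * T ^ 1 ≤ ε / 2 := by rw [pow_one]; nlinarith
        linarith
      · have h2 := abs_lt.1 (hℓ z hz)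
        rw [Real.norm_eq_abs, abs_le]
        have h3 := neg_abs_le (LieD f (ψ R) x0)
        have h4 := le_abs_self (LieD f (ψ R) x0)
        constructor <;> linarith
    have h2 := hA T hT hT1 e hode hBR
    rw [Nat.sub_self, add_comm 1 R] at h2
    exact hfin K1 l1 hl1 (min_le_left _ _) h2
  · -- case B
    have h1 : α (R+1) (cc α R - ε) ≤ α (R+1) (ψ R x) := hα2.monotone (not_le.1 hcase).le
    have h2 : LieD f (ψ R) x < - (cr / 2) := by linarith
    have h0 := abs_lt.1 (hℓ 0 ⟨le_rfl, hT.le⟩)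
    rw [hγ0] at h0
    have hB1 : BigOn (fun t => LieD f (ψ R) (γ t)) T (cr/4) 1 0 := by
      refine ⟨0, le_rfl, by simp, Or.inr fun t ht => ?_⟩
      have ht' : t ∈ Icc 0 T := by simpa using ht
      have h3 := abs_lt.1 (hℓ t ht')
      rw [pow_zero, mul_one]
      linarith
    have hB2 : BigOn (e R) T K2 (1/4) 1 := by
      refine hB0 T hT hT1 (e R) _ (fun t ht => ?_) hB1
      simpa using hder R le_rfl t ht
    have h3 := hB T hT hT1 e hode hB2
    rw [Nat.sub_self, add_comm 1 R] at h3
    exact hfin K3 l3 hl3 (min_le_right _ _) h3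

lemma u_lip_singular (S : SF R f g b D ξ χ α ψ) {x : EuclideanSpace ℝ (Fin n)} (hx : x ∈ D)
    (h0 : (fderiv ℝ (ψ R) x).comp (g x) = 0)
    {unom u : EuclideanSpace ℝ (Fin n) → EuclideanSpace ℝ (Fin m)}
    (hbd : ∃ M : ℝ, ∀ x ∈ D, ‖unom x‖ ≤ M)
    (hun : LocallyLipschitzOn D unom) {μ : EuclideanSpace ℝ (Fin n) → ℝ}
    (hμ : ∀ x ∈ D, μ x =
      if 0 ≤ fderiv ℝ (ψ R) x (g x (unom x)) + α (R+1) (ψ R x) + LieD f (ψ R) x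
      then 0
      else -(fderiv ℝ (ψ R) x (g x (unom x)) + α (R+1) (ψ R x) + LieD f (ψ R) x)
           / ‖(fderiv ℝ (ψ R) x).comp (g x)‖ ^ 2)
    (hu : ∀ x ∈ D, u x = unom x + μ x •
      (InnerProductSpace.toDual ℝ (EuclideanSpace ℝ (Fin m))).symm
        ((fderiv ℝ (ψ R) x).comp (g x))) : LipAt u x := by
  have key : ∀ᶠ z in 𝓝 x, (fderiv ℝ (ψ R) z).comp (g z) ≠ 0 →
      0 ≤ fderiv ℝ (ψ R) z (g z (unom z)) + α (R+1) (ψ R z) + LieD f (ψ R) z := by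
    rcases lt_trichotomy (b x) ξ with h | h | h
    · exact (S.Lg_zero_near hx h h0).mono fun z hz hne => absurd hz hne
    · exact S.singular hx h hbd
    · have h1 : ∀ᶠ z in 𝓝 x, ξ < b z := continuousAt_const.eventually_lt S.bcont.continuousAt h
      filter_upwards [h1, S.hD.mem_nhds hx] with z hz hzD hne
      exact absurd (S.Lg_zero hzD hz.le) hne
  refine (lip_at S.hD hun hx).congr ?_
  filter_upwards [key, S.hD.mem_nhds hx] with z hz hzD
  rw [hu z hzD]
  by_cases hne : (fderiv ℝ (ψ R) z).comp (g z) = 0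
  · rw [hne]; simp
  · rw [hμ z hzD, if_pos (hz hne)]; simp

end SF


end Helpers

/-- Proposition 5, part 1: the closed-form safety-filter
controller `u(x) = u_nom(x) + μ(x) L_g ψ_{r−1}(x)ᵀ` is well-defined and
locally Lipschitz continuous on `D`. -/
theorem safety_filter_locally_lipschitz {n m r : ℕ} (hr : 1 ≤ r)
    (f : EuclideanSpace ℝ (Fin n) → EuclideanSpace ℝ (Fin n))
    (hf_lip : LocallyLipschitz f) (hf_smooth : ContDiff ℝ (⊤ : ℕ∞) f)
    (g : EuclideanSpace ℝ (Fin n) →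
      (EuclideanSpace ℝ (Fin m) →L[ℝ] EuclideanSpace ℝ (Fin n)))
    (hg_lip : LocallyLipschitz g) (hg_smooth : ContDiff ℝ (⊤ : ℕ∞) g)
    (b : EuclideanSpace ℝ (Fin n) → ℝ) (hb : ContDiff ℝ (⊤ : ℕ∞) b)
    (D : Set (EuclideanSpace ℝ (Fin n))) (hD : IsOpen D)
    (hCbD : {x | 0 ≤ b x} ⊆ D)
    -- b has least relative degree r in D
    (hreldeg : ∀ k, k + 2 ≤ r → ∀ x ∈ D, ∀ u : EuclideanSpace ℝ (Fin m),
      fderiv ℝ ((LieD f)^[k] b) x (g x u) = 0)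
    (ξ : ℝ) (hξ : 0 < ξ)
    -- E ⊆ C_{b,ξ}
    (hE : {x ∈ D | ∀ u : EuclideanSpace ℝ (Fin m),
        fderiv ℝ ((LieD f)^[r - 1] b) x (g x u) = 0} ⊆ {x | ξ ≤ b x})
    (χ : ℝ → ℝ) (hχ_smooth : ContDiff ℝ r χ) (hχ0 : χ 0 = 0)
    (hχ1 : ∀ τ : ℝ, 1 ≤ τ → χ τ = 1) (hχ' : ∀ τ : ℝ, τ < 1 → 0 < deriv χ τ)
    (h : EuclideanSpace ℝ (Fin n) → ℝ) (hdef : ∀ x, h x = χ (b x / ξ))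
    (α : ℕ → ℝ → ℝ)
    (hα : ∀ k, 1 ≤ k → k ≤ r →
      ContDiff ℝ 1 (α k) ∧ StrictMono (α k) ∧ α k 0 = 0)
    (ψ : ℕ → EuclideanSpace ℝ (Fin n) → ℝ)
    (hψ0 : ψ 0 = h)
    (hψ : ∀ k, k + 2 ≤ r → ∀ x,
      ψ (k + 1) x = LieD f (ψ k) x + α (k + 1) (ψ k x))
    -- the nominal controller: bounded and locally Lipschitz on D
    (unom : EuclideanSpace ℝ (Fin n) → EuclideanSpace ℝ (Fin m))
    (hunom_bdd : ∃ M : ℝ, ∀ x ∈ D, ‖unom x‖ ≤ M)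
    (hunom_lip : LocallyLipschitzOn D unom)
    -- L_g ψ_{r−1} and L_f ψ_{r−1} are locally Lipschitz on D
    (hLg_lip : LocallyLipschitzOn D
      (fun x => (fderiv ℝ (ψ (r - 1)) x).comp (g x)))
    (hLf_lip : LocallyLipschitzOn D (LieD f (ψ (r - 1))))
    -- the KKT multiplier μ and the filtered controller u
    (μ : EuclideanSpace ℝ (Fin n) → ℝ)
    (hμ : ∀ x ∈ D, μ x =
      if 0 ≤ fderiv ℝ (ψ (r - 1)) x (g x (unom x)) + α r (ψ (r - 1) x)
              + LieD f (ψ (r - 1)) x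
      then 0
      else -(fderiv ℝ (ψ (r - 1)) x (g x (unom x)) + α r (ψ (r - 1) x)
              + LieD f (ψ (r - 1)) x)
           / ‖(fderiv ℝ (ψ (r - 1)) x).comp (g x)‖ ^ 2)
    (u : EuclideanSpace ℝ (Fin n) → EuclideanSpace ℝ (Fin m))
    (hu : ∀ x ∈ D, u x = unom x + μ x •
      (InnerProductSpace.toDual ℝ (EuclideanSpace ℝ (Fin m))).symm
        ((fderiv ℝ (ψ (r - 1)) x).comp (g x))) :
    LocallyLipschitzOn D u := by
  obtain ⟨R, rfl⟩ : ∃ R, r = R + 1 := ⟨r - 1, by omega⟩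
  simp only [Nat.add_sub_cancel] at hE hLg_lip hLf_lip hμ hu
  have S : SF R f g b D ξ χ α ψ :=
    { hf := hf_smooth
      hg := hg_smooth
      hb := hb
      hD := hD
      hrel := fun i hi => hreldeg i (by omega)
      hξ := hξ
      hE := by
        intro x hx hbx
        by_contra hcon
        push Not at hcon
        exact absurd (hE ⟨hx, hcon⟩) (not_le.2 hbx)
      hχ := hχ_smooth
      hχ1 := hχ1
      hχd := hχ'
      hα := hα
      hψ0 := fun x => by rw [hψ0, hdef]
      hψ := fun k hk x => hψ k (by omega) x
      hLg := hLg_lip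
      hLf := hLf_lip }
  intro x hx
  have hl : LipAt u x := by
    by_cases hne : (fderiv ℝ (ψ R) x).comp (g x) = 0
    · exact S.u_lip_singular hx hne hunom_bdd hunom_lip hμ hu
    · exact S.u_lip_regular hx hne hunom_lip hμ hu
  obtain ⟨K, t, ht, h⟩ := hl
  exact ⟨K, t, mem_nhdsWithin_of_mem_nhds ht, h⟩
end
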